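/- There exists an absolute constant C > 0 such that for every prime p and positive integer k with q = p^k, if no nonprincipal Dirichlet character modulo q has a real zero β with β ≥ 1 − c0/log q (nonexistence of the exceptional zero), then Σ_{χ ≠ χ0, χ(−1)=1} (f_χ · |L(1,χ)|^2)^{−1} ≤ C·k + C·k^2 (log p)^2 (log k + log log p)^2 / p; in particular when k ≫ p/(log p)^4 this gives Σ_{χ ≠ χ0, χ(−1)=1} (f_χ · |L(1,χ)|^2)^{−1} ≪ k^2 (log p)^2 (log k + log log p)^2 / p. -/

import Mathlib

open Complex DirichletCharacter

namespace NSM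

/-- partial character sums -/
noncomputable def chS {Q : ℕ} (χ : DirichletCharacter ℂ Q) (n : ℕ) : ℂ :=
  ∑ m ∈ Finset.range (n + 1), χ (m : ZMod Q)

lemma sum_period {Q : ℕ} [NeZero Q] (f : ZMod Q → ℂ) (m : ℕ) :
    ∑ i ∈ Finset.range Q, f ((m + i : ℕ) : ZMod Q) = ∑ x : ZMod Q, f x := by
  have h1 : ∑ x : ZMod Q, f x = ∑ x : ZMod Q, f (m + x) :=
    (Fintype.sum_equiv (Equiv.addLeft (m : ZMod Q)) _ _ (fun x => rfl)).symm
  rw [h1]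
  refine Finset.sum_bij' (fun i _ => (i : ZMod Q)) (fun x _ => x.val) ?_ ?_ ?_ ?_ ?_
  · intros; simp
  · intro x _; simpa using ZMod.val_lt x
  · intro a ha; exact ZMod.val_cast_of_lt (by simpa using ha)
  · intro x _; simp
  · intro a _; simp

lemma sum_range_norm_le {Q : ℕ} [NeZero Q] {χ : DirichletCharacter ℂ Q} (hχ : χ ≠ 1) (n : ℕ) :
    ‖∑ m ∈ Finset.range n, χ (m : ZMod Q)‖ ≤ Q := by
  induction n using Nat.strong_induction_on with
  | _ n ih =>
    rcases le_or_gt n Q with h | h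
    · refine (norm_sum_le _ _).trans ?_
      refine (Finset.sum_le_sum (fun i _ => χ.norm_le_one _)).trans ?_
      simpa using h
    · obtain ⟨m, rfl⟩ : ∃ m, n = m + Q := ⟨n - Q, by omega⟩
      have hQ : 0 < Q := NeZero.pos Q
      rw [Finset.sum_range_add, sum_period (fun x => χ x), MulChar.sum_eq_zero_of_ne_one hχ, add_zero]
      exact ih m (by omega)

lemma chi_zero {Q : ℕ} {χ : DirichletCharacter ℂ Q} (hχ : χ ≠ 1) : χ 0 = 0 := by
  apply χ.map_zero'
  rintro rfl
  exact hχ (level_one χ)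

lemma chS_le_Q {Q : ℕ} [NeZero Q] {χ : DirichletCharacter ℂ Q} (hχ : χ ≠ 1) (n : ℕ) :
    ‖chS χ n‖ ≤ Q := sum_range_norm_le hχ _

lemma chS_zero {Q : ℕ} {χ : DirichletCharacter ℂ Q} (hχ : χ ≠ 1) : chS χ 0 = 0 := by
  simp [chS, chi_zero hχ]

lemma chS_succ {Q : ℕ} (χ : DirichletCharacter ℂ Q) (n : ℕ) :
    chS χ (n + 1) = chS χ n + χ ((n + 1 : ℕ) : ZMod Q) := by
  rw [chS, Finset.sum_range_succ, chS]

lemma chS_le_n {Q : ℕ} {χ : DirichletCharacter ℂ Q} (hχ : χ ≠ 1) (n : ℕ) :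
    ‖chS χ n‖ ≤ n := by
  induction n with
  | zero => simp [chS_zero hχ]
  | succ n ih =>
    rw [chS_succ]
    refine (norm_add_le _ _).trans ?_
    push_cast
    have := χ.norm_le_one ((n + 1 : ℕ) : ZMod Q)
    push_cast at this
    linarith

lemma chS_le_interp {Q : ℕ} [NeZero Q] {χ : DirichletCharacter ℂ Q} (hχ : χ ≠ 1) (n : ℕ)
    {η : ℝ} (h0 : 0 ≤ η) (h1 : η ≤ 1) :
    ‖chS χ n‖ ≤ (Q : ℝ) ^ η * (n : ℝ) ^ (1 - η) := by
  rcases (norm_nonneg (chS χ n)).eq_or_lt with h | h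
  · rw [← h]; positivity
  · calc ‖chS χ n‖ = ‖chS χ n‖ ^ η * ‖chS χ n‖ ^ (1 - η) := by
          rw [← Real.rpow_add h]; simp
      _ ≤ _ := by
          have h2 : 0 ≤ 1 - η := by linarith
          exact mul_le_mul (Real.rpow_le_rpow h.le (chS_le_Q hχ n) h0)
            (Real.rpow_le_rpow h.le (chS_le_n hχ n) h2) (by positivity) (by positivity)

/-- differences of powers -/
noncomputable def dpow (n : ℕ) (s : ℂ) : ℂ := ((n : ℂ) + 1) ^ (-s) - ((n : ℂ) + 2) ^ (-s)

lemma dpow_norm_le (n : ℕ) {s : ℂ} (hs : 0 < s.re) :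
    ‖dpow n s‖ ≤ ‖s‖ * ((n : ℝ) + 1) ^ (-(s.re + 1)) := by
  have key := Convex.norm_image_sub_le_of_norm_hasDerivWithin_le (𝕜 := ℝ)
    (f := fun t : ℝ => (t : ℂ) ^ (-s)) (f' := fun t : ℝ => (-s) * (t : ℂ) ^ (-s - 1))
    (s := Set.Icc ((n : ℝ) + 1) ((n : ℝ) + 2)) (x := (n : ℝ) + 2) (y := (n : ℝ) + 1)
    (C := ‖s‖ * ((n : ℝ) + 1) ^ (-(s.re + 1))) ?_ ?_ (convex_Icc _ _) ?_ ?_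
  · have e : ‖((n : ℝ) + 1) - ((n : ℝ) + 2)‖ = 1 := by norm_num
    rw [e, mul_one] at key
    simpa [dpow] using key
  · intro t ht
    have ht0 : t ≠ 0 := by
      have := ht.1
      have h0 : (0 : ℝ) ≤ n := n.cast_nonneg
      intro h; linarith
    have hs0 : -s ≠ 0 := by
      intro h; rw [neg_eq_zero] at h; simp [h] at hs
    exact (hasDerivAt_ofReal_cpow_const ht0 hs0).hasDerivWithinAt
  · intro t ht
    have ht0 : 0 < t := by have := ht.1; have : (0:ℝ) ≤ n := n.cast_nonneg; linarith
    rw [norm_mul, norm_neg, Complex.norm_cpow_eq_rpow_re_of_pos ht0]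
    gcongr
    simp only [sub_re, neg_re, one_re]
    rw [show -s.re - 1 = -(s.re + 1) by ring]
    exact Real.rpow_le_rpow_of_nonpos (by positivity) ht.1 (by linarith)
  · constructor <;> linarith
  · constructor <;> linarith

lemma abel_finite {Q : ℕ} {χ : DirichletCharacter ℂ Q} (hχ : χ ≠ 1) (s : ℂ) (N : ℕ) :
    ∑ n ∈ Finset.range N, χ ((n + 1 : ℕ) : ZMod Q) * ((n : ℂ) + 1) ^ (-s) =
      ∑ n ∈ Finset.range N, chS χ (n + 1) * dpow n s + chS χ N * ((N : ℂ) + 1) ^ (-s) := by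
  induction N with
  | zero => simp [chS_zero hχ]
  | succ N ih =>
    rw [Finset.sum_range_succ, ih, Finset.sum_range_succ, chS_succ, dpow]
    push_cast
    rw [show (N : ℂ) + 1 + 1 = N + 2 by ring]
    ring

lemma summable_shift {a : ℝ} (ha : 1 < a) : Summable (fun n : ℕ => ((n : ℝ) + 1) ^ (-a)) := by
  have h := (Real.summable_nat_rpow (p := -a)).2 (by linarith)
  simpa using (summable_nat_add_iff 1).2 h

/-- the constant in the convexity-free bound -/
noncomputable def Zc (η : ℝ) : ℝ := ∑' n : ℕ, ((n : ℝ) + 1) ^ (-(1 + η / 2))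

lemma Zc_nonneg (η : ℝ) : 0 ≤ Zc η := tsum_nonneg (fun n => by positivity)

lemma one_le_Zc {η : ℝ} (hη : 0 < η) : 1 ≤ Zc η := by
  have := (summable_shift (a := 1 + η / 2) (by linarith)).sum_le_tsum {0}
    (fun n _ => by positivity)
  simpa [Zc] using this

lemma term_norm_le {Q : ℕ} [NeZero Q] {χ : DirichletCharacter ℂ Q} (hχ : χ ≠ 1) (n : ℕ)
    {η : ℝ} (h0 : 0 < η) (h1 : η ≤ 1) {s : ℂ} (hs : 1 - η / 2 ≤ s.re) :
    ‖chS χ (n + 1) * dpow n s‖ ≤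
      (Q : ℝ) ^ η * ‖s‖ * ((n : ℝ) + 1) ^ (-(1 + η / 2)) := by
  have hn : (0 : ℝ) < (n : ℝ) + 1 := by positivity
  rw [norm_mul]
  calc _ ≤ ((Q : ℝ) ^ η * ((n + 1 : ℕ) : ℝ) ^ (1 - η)) * (‖s‖ * ((n : ℝ) + 1) ^ (-(s.re + 1))) :=
        mul_le_mul (chS_le_interp hχ _ h0.le h1) (dpow_norm_le n (by linarith)) (norm_nonneg _)
          (by positivity)
    _ = (Q : ℝ) ^ η * ‖s‖ * ((n : ℝ) + 1) ^ ((1 - η) + (-(s.re + 1))) := by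
        rw [Real.rpow_add hn]; push_cast; ring
    _ ≤ _ := by
        gcongr
        · linarith
        · linarith

lemma term_norm_le' {Q : ℕ} [NeZero Q] {χ : DirichletCharacter ℂ Q} (hχ : χ ≠ 1) (n : ℕ)
    {a B : ℝ} (ha : 0 < a) {s : ℂ} (hs : a ≤ s.re) (hB : ‖s‖ ≤ B) :
    ‖chS χ (n + 1) * dpow n s‖ ≤
      Q * B * ((n : ℝ) + 1) ^ (-(1 + a)) := by
  rw [norm_mul]
  calc _ ≤ (Q : ℝ) * (‖s‖ * ((n : ℝ) + 1) ^ (-(s.re + 1))) :=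
        mul_le_mul (chS_le_Q hχ _) (dpow_norm_le n (by linarith)) (norm_nonneg _)
          (by positivity)
    _ ≤ Q * (B * ((n : ℝ) + 1) ^ (-(1 + a))) := by
        have h3 : ((n : ℝ) + 1) ^ (-(s.re + 1)) ≤ ((n : ℝ) + 1) ^ (-(1 + a)) := by
          apply Real.rpow_le_rpow_of_exponent_le
          · have : (0 : ℝ) ≤ n := n.cast_nonneg
            linarith
          · linarith
        have hB0 : 0 ≤ B := (norm_nonneg s).trans hB
        gcongr
    _ = _ := by ring

lemma summable_term {Q : ℕ} [NeZero Q] {χ : DirichletCharacter ℂ Q} (hχ : χ ≠ 1)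
    {s : ℂ} (hs : 0 < s.re) : Summable (fun n => chS χ (n + 1) * dpow n s) :=
  Summable.of_norm_bounded ((summable_shift (a := 1 + s.re) (by linarith)).mul_left (Q * ‖s‖))
    (fun n => term_norm_le' hχ n hs le_rfl le_rfl)

lemma tendsto_pow_zero {s : ℂ} (hs : 0 < s.re) :
    Filter.Tendsto (fun N : ℕ => ((N : ℂ) + 1) ^ (-s)) Filter.atTop (nhds 0) := by
  rw [tendsto_zero_iff_norm_tendsto_zero]
  have h : ∀ N : ℕ, ‖((N : ℂ) + 1) ^ (-s)‖ = ((N + 1 : ℕ) : ℝ) ^ (-s.re) := by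
    intro N
    have := Complex.norm_natCast_cpow_of_pos (Nat.succ_pos N) (-s)
    rw [neg_re] at this
    rw [← this]
    push_cast; rfl
  simp_rw [h]
  exact ((tendsto_rpow_neg_atTop hs).comp tendsto_natCast_atTop_atTop).comp
    (Filter.tendsto_add_atTop_nat 1)

lemma tendsto_partial {Q : ℕ} [NeZero Q] {χ : DirichletCharacter ℂ Q} (hχ : χ ≠ 1)
    {s : ℂ} (hs : 0 < s.re) :
    Filter.Tendsto (fun N : ℕ => ∑ n ∈ Finset.range N,
      χ ((n + 1 : ℕ) : ZMod Q) * ((n : ℂ) + 1) ^ (-s)) Filter.atTop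
      (nhds (∑' n, chS χ (n + 1) * dpow n s)) := by
  simp_rw [abel_finite hχ s]
  have h1 := (summable_term hχ hs).hasSum.tendsto_sum_nat
  have h2 : Filter.Tendsto (fun N : ℕ => chS χ N * ((N : ℂ) + 1) ^ (-s)) Filter.atTop (nhds 0) := by
    rw [tendsto_zero_iff_norm_tendsto_zero]
    have h3 := (tendsto_zero_iff_norm_tendsto_zero.1 (tendsto_pow_zero hs)).const_mul (Q : ℝ)
    rw [mul_zero] at h3
    refine squeeze_zero (fun _ => norm_nonneg _) (fun N => ?_) h3
    rw [norm_mul]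
    gcongr
    exact chS_le_Q hχ N
  simpa using h1.add h2

lemma LFunction_eq_of_one_lt {Q : ℕ} [NeZero Q] {χ : DirichletCharacter ℂ Q} (hχ : χ ≠ 1)
    {s : ℂ} (hs : 1 < s.re) :
    χ.LFunction s = ∑' n, chS χ (n + 1) * dpow n s := by
  rw [LFunction_eq_LSeries χ hs]
  have h := (LSeriesSummable_of_one_lt_re χ hs)
  have h1 := ((hasSum_nat_add_iff' 1).2 (show HasSum _ _ from h.hasSum)).tendsto_sum_nat
  refine tendsto_nhds_unique ?_ (tendsto_partial hχ (s := s) (by linarith))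
  simp only [Finset.range_one, Finset.sum_singleton, LSeries.term_zero, sub_zero] at h1
  refine h1.congr (fun N => ?_)
  refine Finset.sum_congr rfl (fun n _ => ?_)
  rw [LSeries.term_of_ne_zero (by omega), Complex.cpow_neg, div_eq_mul_inv]
  push_cast
  rfl

lemma differentiableOn_series {Q : ℕ} [NeZero Q] {χ : DirichletCharacter ℂ Q} (hχ : χ ≠ 1) :
    DifferentiableOn ℂ (fun s => ∑' n, chS χ (n + 1) * dpow n s) {s : ℂ | 0 < s.re} := by
  intro s hs
  have hs : 0 < s.re := hs
  set U : Set ℂ := {z : ℂ | s.re / 2 < z.re} ∩ Metric.ball 0 (‖s‖ + 1) with hU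
  have hUo : IsOpen U := (isOpen_lt continuous_const continuous_re).inter Metric.isOpen_ball
  have hsU : s ∈ U := by
    refine ⟨?_, ?_⟩
    · simp only [Set.mem_ofPred_eq]; linarith
    · simp
  have := differentiableOn_tsum_of_summable_norm (U := U)
    (F := fun n s => chS χ (n + 1) * dpow n s)
    ((summable_shift (a := 1 + s.re / 2) (by linarith)).mul_left (Q * (‖s‖ + 1))) ?_ hUo ?_
  · exact (this.differentiableAt (hUo.mem_nhds hsU)).differentiableWithinAt
  · intro n
    apply Differentiable.differentiableOn
    unfold dpow
    refine Differentiable.const_mul (Differentiable.sub ?_ ?_) _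
    · refine Differentiable.const_cpow differentiable_id.neg (Or.inl ?_)
      exact_mod_cast Nat.succ_ne_zero n
    · refine Differentiable.const_cpow differentiable_id.neg (Or.inl ?_)
      exact_mod_cast Nat.succ_ne_zero (n + 1)
  · intro n w hw
    refine term_norm_le' hχ n (by linarith) (le_of_lt hw.1) ?_
    have := hw.2
    simp at this
    exact this.le

lemma LFunction_eq {Q : ℕ} [NeZero Q] {χ : DirichletCharacter ℂ Q} (hχ : χ ≠ 1)
    {s : ℂ} (hs : 0 < s.re) :
    χ.LFunction s = ∑' n, chS χ (n + 1) * dpow n s := by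
  have hUo : IsOpen {s : ℂ | 0 < s.re} := isOpen_lt continuous_const continuous_re
  have hA := (differentiableOn_series hχ).analyticOnNhd hUo
  have hL := ((differentiable_LFunction hχ).differentiableOn (s := {s : ℂ | 0 < s.re})).analyticOnNhd hUo
  have hc : IsPreconnected {s : ℂ | 0 < s.re} := (convex_halfSpace_re_gt 0).isPreconnected
  refine hL.eqOn_of_preconnected_of_eventuallyEq hA hc (z₀ := 2) (by simp) ?_ hs
  have : {s : ℂ | 1 < s.re} ∈ nhds (2 : ℂ) :=
    (isOpen_lt continuous_const continuous_re).mem_nhds (by simp)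
  filter_upwards [this] with z hz
  exact LFunction_eq_of_one_lt hχ hz

lemma LFunction_norm_le {Q : ℕ} [NeZero Q] {χ : DirichletCharacter ℂ Q} (hχ : χ ≠ 1)
    {η : ℝ} (h0 : 0 < η) (h1 : η ≤ 1) {s : ℂ} (hs : 1 - η / 2 ≤ s.re) :
    ‖χ.LFunction s‖ ≤ (Q : ℝ) ^ η * ‖s‖ * Zc η := by
  rw [LFunction_eq hχ (by linarith), Zc, ← tsum_mul_left]
  exact tsum_of_norm_bounded
    ((summable_shift (a := 1 + η / 2) (by linarith)).mul_left _).hasSum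
    (fun n => term_norm_le hχ n h0 h1 hs)

lemma dpow_one (n : ℕ) : dpow n 1 = (((1 : ℝ) / (n + 1) - 1 / (n + 2) : ℝ) : ℂ) := by
  simp [dpow, Complex.cpow_neg_one]

lemma LFunction_one_sub_partial {Q : ℕ} [NeZero Q] {χ : DirichletCharacter ℂ Q} (hχ : χ ≠ 1)
    (N : ℕ) :
    ‖χ.LFunction 1 - ∑ n ∈ Finset.range N, χ ((n + 1 : ℕ) : ZMod Q) * ((n : ℂ) + 1)⁻¹‖
      ≤ 2 * Q / (N + 1) := by
  have hT := (summable_term hχ (s := 1) (by simp)).hasSum.tendsto_sum_nat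
  rw [← LFunction_eq hχ (by simp)] at hT
  have hQ : (0 : ℝ) ≤ Q := Q.cast_nonneg
  have key : ∀ M, N ≤ M → ‖∑ n ∈ Finset.range M, chS χ (n + 1) * dpow n 1 -
      ∑ n ∈ Finset.range N, chS χ (n + 1) * dpow n 1‖ ≤ Q * (1 / ((N : ℝ) + 1) - 1 / ((M : ℝ) + 1)) := by
    intro M hM
    induction M, hM using Nat.le_induction with
    | base => simp
    | succ M hM ih =>
      rw [Finset.sum_range_succ, add_sub_right_comm]
      refine (norm_add_le _ _).trans ?_
      have h1 : ‖chS χ (M + 1) * dpow M 1‖ ≤ Q * ((1 : ℝ) / (M + 1) - 1 / (M + 2)) := by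
        rw [norm_mul, dpow_one, Complex.norm_real, Real.norm_of_nonneg]
        · gcongr
          · rw [sub_nonneg]; gcongr; norm_num
          · exact chS_le_Q hχ _
        · rw [sub_nonneg]; gcongr; norm_num
      have e : (((M + 1 : ℕ) : ℝ) + 1) = M + 2 := by push_cast; ring
      rw [e]
      linarith
  have h2 : ‖χ.LFunction 1 - ∑ n ∈ Finset.range N, chS χ (n + 1) * dpow n 1‖ ≤ Q / (N + 1) := by
    refine le_of_tendsto ((hT.sub_const _).norm) ?_
    filter_upwards [Filter.eventually_ge_atTop N] with M hM
    refine (key M hM).trans ?_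
    rw [div_eq_mul_one_div (Q : ℝ)]
    have : (0 : ℝ) ≤ 1 / ((M : ℝ) + 1) := by positivity
    exact mul_le_mul_of_nonneg_left (by linarith) hQ
  have h3 := abel_finite hχ 1 N
  simp only [Complex.cpow_neg_one] at h3
  rw [h3, ← sub_sub]
  refine (norm_sub_le _ _).trans ?_
  have h4 : ‖chS χ N * ((N : ℂ) + 1)⁻¹‖ ≤ Q / (N + 1) := by
    rw [norm_mul, norm_inv, div_eq_mul_inv]
    have : ‖(N : ℂ) + 1‖ = N + 1 := by
      have := Complex.norm_natCast (N + 1)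
      push_cast at this; exact this
    rw [this]
    gcongr
    exact chS_le_Q hχ _
  calc _ ≤ (Q : ℝ) / (N + 1) + Q / (N + 1) := add_le_add h2 h4
    _ = _ := by ring

end NSM

namespace NSM

/-- the entire function `(s-1) ζ(s)` -/
noncomputable def Z1 (s : ℂ) : ℂ := LFunctionTrivChar₁ 1 s

lemma Z1_diff : Differentiable ℂ Z1 := differentiable_LFunctionTrivChar₁ 1

lemma Z1_apply {s : ℂ} (hs : s ≠ 1) : Z1 s = (s - 1) * riemannZeta s := by
  simp [Z1, LFunctionTrivChar₁, hs, LFunctionTrivChar]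

lemma Z1_one : Z1 1 = 1 := by
  simp [Z1, LFunctionTrivChar₁]

lemma triv_norm_le {Q : ℕ} [NeZero Q] {x : ℝ} (hx : 0 < x) :
    ‖LFunctionTrivChar Q (1 + x)‖ ≤ ‖riemannZeta (1 + x)‖ := by
  have hne : (1 + x : ℂ) ≠ 1 := by
    intro h; apply hx.ne'; simpa using h
  rw [LFunctionTrivChar_eq_mul_riemannZeta hne, norm_mul]
  apply mul_le_of_le_one_left (norm_nonneg _)
  rw [norm_prod]
  apply Finset.prod_le_one (fun _ _ => norm_nonneg _)
  intro p hp
  have hp : p.Prime := Nat.prime_of_mem_primeFactors hp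
  have h1 : (p : ℂ) ^ (-(1 + x : ℂ)) = (((p : ℝ) ^ (-(1 + x)) : ℝ) : ℂ) := by
    rw [Complex.ofReal_cpow (by positivity)]; push_cast; rfl
  have h2 : (p : ℝ) ^ (-(1 + x)) ≤ 1 :=
    Real.rpow_le_one_of_one_le_of_nonpos (by exact_mod_cast hp.one_lt.le) (by linarith)
  have h3 : 0 ≤ (p : ℝ) ^ (-(1 + x)) := by positivity
  rw [h1, ← Complex.ofReal_one, ← Complex.ofReal_sub, Complex.norm_real, Real.norm_eq_abs, abs_le]
  constructor <;> linarith

lemma zeta_bound : ∃ K ≥ (1 : ℝ), ∀ x : ℝ, 0 < x → x ≤ 1 → ‖riemannZeta (1 + x)‖ ≤ K / x := by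
  obtain ⟨K, hK⟩ := (isCompact_Icc (a := (0 : ℝ)) (b := 1)).exists_bound_of_continuousOn
    (f := fun x : ℝ => Z1 (1 + x)) (by
      apply Continuous.continuousOn
      exact Z1_diff.continuous.comp (by fun_prop))
  refine ⟨max K 1, le_max_right _ _, fun x hx hx1 => ?_⟩
  have hne : (1 + x : ℂ) ≠ 1 := by
    intro h; apply hx.ne'; simpa using h
  have h := hK x ⟨hx.le, hx1⟩
  rw [Z1_apply hne, norm_mul] at h
  have : ‖(1 + x : ℂ) - 1‖ = x := by
    rw [add_sub_cancel_left, Complex.norm_real, Real.norm_of_nonneg hx.le]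
  rw [this] at h
  rw [le_div_iff₀ hx]
  calc _ = x * ‖riemannZeta (1 + x)‖ := mul_comm _ _
    _ ≤ K := h
    _ ≤ _ := le_max_left _ _

lemma LFunction_sub_le {Q : ℕ} [NeZero Q] {χ : DirichletCharacter ℂ Q} (hχ : χ ≠ 1)
    {η : ℝ} (h0 : 0 < η) (h1 : η ≤ 1) {x : ℝ} (hx : 0 < x) (hx1 : x ≤ 1) :
    ‖χ.LFunction (1 + x) - χ.LFunction 1‖ ≤ (6 / η * Zc η) * (Q : ℝ) ^ η * x := by
  have hd := differentiable_LFunction hχ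
  have hder : ∀ t ∈ Set.Icc (0 : ℝ) 1, ‖deriv χ.LFunction (1 + t)‖ ≤
      (6 / η * Zc η) * (Q : ℝ) ^ η := by
    intro t ht
    have := Complex.norm_deriv_le_of_forall_mem_sphere_norm_le (c := (1 + t : ℂ)) (R := η / 2)
      (C := (Q : ℝ) ^ η * 3 * Zc η) (f := χ.LFunction) (by positivity) hd.diffContOnCl ?_
    · refine this.trans (le_of_eq ?_)
      field_simp; ring
    · intro z hz
      rw [mem_sphere_iff_norm] at hz
      have hre : |(z - (1 + t)).re| ≤ η / 2 := hz ▸ Complex.abs_re_le_norm _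
      rw [abs_le] at hre
      simp at hre
      refine (LFunction_norm_le hχ h0 h1 (s := z) (by linarith [ht.1, hre.1])).trans ?_
      have hz3 : ‖z‖ ≤ 3 := by
        calc ‖z‖ = ‖(z - (1 + t)) + ((1 + t : ℝ) : ℂ)‖ := by congr 1; push_cast; ring
          _ ≤ η / 2 + (1 + t) := by
            refine (norm_add_le _ _).trans ?_
            rw [hz, Complex.norm_real, Real.norm_of_nonneg (by linarith [ht.1])]
          _ ≤ 3 := by linarith [ht.2]
      have := Zc_nonneg η
      gcongr
  have := Convex.norm_image_sub_le_of_norm_hasDerivWithin_le (𝕜 := ℝ)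
    (f := fun t : ℝ => χ.LFunction (1 + t)) (f' := fun t : ℝ => deriv χ.LFunction (1 + t))
    (s := Set.Icc (0 : ℝ) 1) (x := 0) (y := x) (C := (6 / η * Zc η) * (Q : ℝ) ^ η) ?_ hder
    (convex_Icc _ _) (by simp) ⟨hx.le, hx1⟩
  · simpa [abs_of_pos hx] using this
  · intro t ht
    have h1 : HasDerivAt χ.LFunction (deriv χ.LFunction (1 + t)) (1 + t) := (hd _).hasDerivAt
    have h2 : HasDerivAt (fun t : ℝ => (1 + t : ℂ)) 1 t :=
      (Complex.ofRealCLM.hasDerivAt (x := t)).const_add 1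
    have h3 := (h1.comp t h2).hasDerivWithinAt (s := Set.Icc (0 : ℝ) 1)
    rw [mul_one] at h3
    exact h3

/-- lower bound for complex characters -/
lemma complex_lower : ∃ c > (0 : ℝ), ∀ (Q : ℕ) [NeZero Q] (χ : DirichletCharacter ℂ Q),
    χ ^ 2 ≠ 1 → c * (Q : ℝ) ^ (-(1 / 8) : ℝ) ≤ ‖χ.LFunction 1‖ := by
  obtain ⟨K, hK1, hK⟩ := zeta_bound
  set η : ℝ := 1 / 32 with hη
  set D : ℝ := 6 / η * Zc η with hD
  have hZ : 1 ≤ Zc η := one_le_Zc (by rw [hη]; norm_num)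
  have hD1 : 1 ≤ D := by
    rw [hD, hη]; norm_num; linarith
  refine ⟨D * (1 / (48 * K ^ 3 * Zc η * D ^ 4)), by positivity, fun Q _ χ hχ2 => ?_⟩
  have hχ : χ ≠ 1 := by rintro rfl; simp at hχ2
  have hQ1 : (1 : ℝ) ≤ Q := by exact_mod_cast NeZero.one_le
  set w : ℝ := (Q : ℝ) ^ η with hw
  have hw1 : 1 ≤ w := Real.one_le_rpow hQ1 (by rw [hη]; norm_num)
  have hw4 : (Q : ℝ) ^ (-(1 / 8) : ℝ) = (w ^ 4)⁻¹ := by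
    rw [hw, Real.rpow_neg (by positivity), ← Real.rpow_natCast, ← Real.rpow_mul (by positivity), hη]
    norm_num
  set P : ℝ := 48 * K ^ 3 * Zc η * D ^ 4 with hP
  have hP1 : 1 ≤ P := by
    have h1 : 1 ≤ K ^ 3 := one_le_pow₀ hK1
    have h2 : 1 ≤ D ^ 4 := one_le_pow₀ hD1
    calc (1 : ℝ) ≤ 48 * 1 * 1 * 1 := by norm_num
      _ ≤ P := by rw [hP]; gcongr
  set x : ℝ := 1 / (P * w ^ 5) with hx
  have hPw : 1 ≤ P * w ^ 5 := one_le_mul_of_one_le_of_one_le hP1 (one_le_pow₀ hw1)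
  have hx0 : 0 < x := by positivity
  have hx1 : x ≤ 1 := by rw [hx, div_le_one (by positivity)]; exact hPw
  have h341 := norm_LFunction_product_ge_one χ hx0 0
  simp only [ofReal_zero, mul_zero, add_zero, norm_mul, norm_pow] at h341
  have hT : ‖LFunctionTrivChar Q (1 + x)‖ ≤ K / x := (triv_norm_le hx0).trans (hK x hx0 hx1)
  have hS : ‖LFunction (χ ^ 2) (1 + x)‖ ≤ w * 3 * Zc η := by
    refine (LFunction_norm_le hχ2 (η := η) (by rw [hη]; norm_num) (by rw [hη]; norm_num)
      (s := 1 + x) ?_).trans ?_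
    · simp; rw [hη]; linarith
    · have : ‖(1 + x : ℂ)‖ ≤ 3 := by
        rw [← ofReal_one, ← ofReal_add, Complex.norm_real, Real.norm_of_nonneg (by linarith)]
        linarith
      gcongr
  set A : ℝ := ‖LFunction χ (1 + x)‖ with hA
  have hA0 : 0 ≤ A := norm_nonneg _
  have h4 : 1 ≤ (K / x) ^ 3 * A ^ 4 * (w * 3 * Zc η) :=
    h341.le.trans (by gcongr)
  have h5 : 2 * D * w * x ≤ A := by
    refine le_of_pow_le_pow_left₀ (n := 4) (by norm_num) hA0 ?_
    have e1 : P * w ^ 5 * x = 1 := by rw [hx]; field_simp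
    have h6 : x ^ 3 ≤ K ^ 3 * A ^ 4 * (w * 3 * Zc η) := by
      have e2 : (K / x) ^ 3 * A ^ 4 * (w * 3 * Zc η) = (K ^ 3 * A ^ 4 * (w * 3 * Zc η)) / x ^ 3 := by
        field_simp
      rw [e2, le_div_iff₀ (by positivity)] at h4
      linarith
    have h7 : (2 * D * w * x) ^ 4 * (K ^ 3 * (w * 3 * Zc η)) = x ^ 3 := by
      calc _ = (P * w ^ 5 * x) * x ^ 3 := by rw [hP]; ring
        _ = _ := by rw [e1, one_mul]
    have h8 : 0 < K ^ 3 * (w * 3 * Zc η) := by positivity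
    rw [← h7] at h6
    refine le_of_mul_le_mul_right ?_ h8
    linarith
  have h6 := LFunction_sub_le hχ (η := η) (by rw [hη]; norm_num) (by rw [hη]; norm_num) hx0 hx1
  rw [← hD, ← hw] at h6
  have h7 : A ≤ ‖χ.LFunction 1‖ + D * w * x := by
    have := norm_sub_norm_le (χ.LFunction (1 + x)) (χ.LFunction 1)
    linarith
  have h8 : D * w * x = D * (1 / P) * (Q : ℝ) ^ (-(1 / 8) : ℝ) := by
    rw [hw4, hx]; field_simp
  rw [← h8]
  linarith

end NSM

section
open scoped ComplexOrder

namespace NSM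

lemma chS_im {Q : ℕ} {χ : DirichletCharacter ℂ Q} (h2 : χ ^ 2 = 1) (n : ℕ) : (chS χ n).im = 0 := by
  rw [chS, Complex.im_sum]
  refine Finset.sum_eq_zero (fun m _ => ?_)
  rcases MulChar.isQuadratic_iff_sq_eq_one.mpr h2 (m : ZMod Q) with h | h | h <;> simp [h]

lemma dpow_im (n : ℕ) (x : ℝ) : (dpow n x).im = 0 := by
  have h1 : ((n : ℂ) + 1) ^ (-(x : ℂ)) = ((((n : ℝ) + 1) ^ (-x) : ℝ) : ℂ) := by
    rw [Complex.ofReal_cpow (by positivity)]; push_cast; rfl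
  have h2 : ((n : ℂ) + 2) ^ (-(x : ℂ)) = ((((n : ℝ) + 2) ^ (-x) : ℝ) : ℂ) := by
    rw [Complex.ofReal_cpow (by positivity)]; push_cast; rfl
  rw [dpow, h1, h2, ← ofReal_sub, ofReal_im]

lemma LFunction_im {Q : ℕ} [NeZero Q] {χ : DirichletCharacter ℂ Q} (hχ : χ ≠ 1) (h2 : χ ^ 2 = 1)
    {x : ℝ} (hx : 0 < x) : (χ.LFunction x).im = 0 := by
  rw [LFunction_eq hχ (by simpa using hx), Complex.im_tsum (summable_term hχ (by simpa using hx))]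
  simp [Complex.mul_im, chS_im h2, dpow_im]

open ArithmeticFunction in
lemma LSeries_zetaMul {Q : ℕ} [NeZero Q] (χ : DirichletCharacter ℂ Q) {s : ℂ} (hs : 1 < s.re) :
    LSeries χ.zetaMul s = riemannZeta s * χ.LFunction s := by
  rw [zetaMul, ← coe_mul, LSeries_convolution']
  · rw [χ.LFunction_eq_LSeries hs]
    congr 1
    · simp_rw [← LSeries_zeta_eq_riemannZeta hs, ← natCoe_apply]
    · exact (LSeries_congr χ.apply_eq_toArithmeticFunction_apply s).symm
  · exact LSeriesSummable_zeta_iff.mpr hs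
  · exact (LSeriesSummable_congr _ fun h ↦ (χ.apply_eq_toArithmeticFunction_apply h).symm).mpr <|
      ZMod.LSeriesSummable_of_one_lt_re χ hs

lemma abscissa_lt {Q : ℕ} (χ : DirichletCharacter ℂ Q) :
    LSeries.abscissaOfAbsConv χ.zetaMul < (2 : ℝ) := by
  have : LSeriesSummable χ.zetaMul ((3 / 2 : ℝ) : ℂ) := LSeriesSummable_zetaMul χ (by
    rw [ofReal_re]; norm_num)
  refine this.abscissaOfAbsConv_le.trans_lt ?_
  rw [ofReal_re]
  exact_mod_cast (by norm_num : (3 / 2 : ℝ) < 2)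

lemma one_le_LSeries_two {Q : ℕ} {χ : DirichletCharacter ℂ Q} (h2 : χ ^ 2 = 1) :
    1 ≤ (LSeries χ.zetaMul 2).re := by
  have hs : LSeriesSummable χ.zetaMul 2 := LSeriesSummable_zetaMul χ (by simp)
  have h := hs.le_tsum 1 (fun j _ => by
    have := LSeries.term_nonneg (zetaMul_nonneg h2 j) (2 : ℝ)
    simpa using this)
  have e : LSeries.term χ.zetaMul 2 1 = 1 := by
    rw [LSeries.term_of_ne_zero one_ne_zero, χ.isMultiplicative_zetaMul.map_one]; simp
  rw [e] at h
  have := (Complex.le_def.1 h).1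
  simpa [LSeries] using this

lemma LFunction_two_pos {Q : ℕ} [NeZero Q] {χ : DirichletCharacter ℂ Q} (h2 : χ ^ 2 = 1) :
    0 < (χ.LFunction 2).re := by
  have h := one_le_LSeries_two h2
  rw [LSeries_zetaMul χ (by simp), riemannZeta_two] at h
  have e : ((Real.pi : ℂ) ^ 2 / 6 * χ.LFunction 2) = ((Real.pi ^ 2 / 6 : ℝ) : ℂ) * χ.LFunction 2 := by
    push_cast; rfl
  rw [e, re_ofReal_mul] at h
  by_contra hc
  push Not at hc
  have : Real.pi ^ 2 / 6 * (χ.LFunction 2).re ≤ 0 :=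
    mul_nonpos_of_nonneg_of_nonpos (by positivity) hc
  linarith

lemma LFunction_pos_of_ne {Q : ℕ} [NeZero Q] {χ : DirichletCharacter ℂ Q} (hχ : χ ≠ 1)
    (h2 : χ ^ 2 = 1) {b : ℝ} (hb : 0 < b) (hne : ∀ x : ℝ, b ≤ x → χ.LFunction x ≠ 0)
    {x : ℝ} (hx : b ≤ x) (hx2 : x ≤ 2) : 0 < (χ.LFunction x).re := by
  by_contra hc
  push Not at hc
  have hcont : ContinuousOn (fun t : ℝ => (χ.LFunction t).re) (Set.Icc x 2) :=
    (continuous_re.comp ((differentiable_LFunction hχ).continuous.comp continuous_ofReal)).continuousOn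
  have := intermediate_value_Icc hx2 hcont (show (0 : ℝ) ∈ _ from ⟨hc, by
    simpa using (LFunction_two_pos h2).le⟩)
  obtain ⟨t, ht, ht0⟩ := this
  apply hne t (hx.trans ht.1)
  apply Complex.ext
  · simpa using ht0
  · simpa using LFunction_im hχ h2 (lt_of_lt_of_le hb (hx.trans ht.1))

/-- auxiliary entire function -/
noncomputable def gF {Q : ℕ} [NeZero Q] (χ : DirichletCharacter ℂ Q) : ℂ → ℂ :=
  dslope (fun s => Z1 s * χ.LFunction s) 1

lemma gF_diff {Q : ℕ} [NeZero Q] {χ : DirichletCharacter ℂ Q} (hχ : χ ≠ 1) :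
    Differentiable ℂ (gF χ) := by
  rw [← differentiableOn_univ, gF, Complex.differentiableOn_dslope Filter.univ_mem]
  exact (Z1_diff.mul (differentiable_LFunction hχ)).differentiableOn

lemma gF_apply {Q : ℕ} [NeZero Q] (χ : DirichletCharacter ℂ Q) {s : ℂ} (hs : s ≠ 1) :
    gF χ s = riemannZeta s * χ.LFunction s - χ.LFunction 1 * (s - 1)⁻¹ := by
  have : s - 1 ≠ 0 := sub_ne_zero.2 hs
  rw [gF, dslope_of_ne _ hs, slope_def_field, Z1_one, Z1_apply hs]
  field_simp

lemma gF_bound : ∃ B ≥ (1 : ℝ), ∀ (Q : ℕ) [NeZero Q] (χ : DirichletCharacter ℂ Q), χ ≠ 1 →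
    ∀ z ∈ Metric.sphere (2 : ℂ) (3 / 2), ‖gF χ z‖ ≤ B * Q := by
  obtain ⟨K, hK⟩ := (isCompact_sphere (2 : ℂ) (3 / 2)).exists_bound_of_continuousOn
    (f := Z1) Z1_diff.continuous.continuousOn
  have hZ := Zc_nonneg 1
  refine ⟨max 1 (2 * (|K| * (4 * Zc 1) + Zc 1)), le_max_left _ _, fun Q _ χ hχ z hz => ?_⟩
  have hKz := (hK z hz).trans (le_abs_self K)
  rw [mem_sphere_iff_norm] at hz
  have hre : |(z - 2).re| ≤ 3 / 2 := hz ▸ Complex.abs_re_le_norm _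
  rw [abs_le] at hre
  simp at hre
  have hz1 : 1 / 2 ≤ ‖z - 1‖ := by
    have := norm_sub_norm_le (z - 2) (-1)
    rw [hz] at this
    rw [show z - 2 - -1 = z - 1 by ring] at this
    norm_num at this; linarith
  have hz4 : ‖z‖ ≤ 4 := by
    calc ‖z‖ = ‖(z - 2) + 2‖ := by congr 1; ring
      _ ≤ 3 / 2 + 2 := by
        refine (norm_add_le _ _).trans ?_
        rw [hz]; norm_num
      _ ≤ 4 := by norm_num
  have hne : z ≠ 1 := by
    rintro rfl; norm_num at hz1
  have hL := LFunction_norm_le hχ (η := 1) one_pos le_rfl (s := z) (by linarith [hre.1])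
  have hL1 := LFunction_norm_le hχ (η := 1) one_pos le_rfl (s := 1) (by simp)
  rw [Real.rpow_one] at hL hL1
  rw [norm_one, mul_one] at hL1
  rw [gF, dslope_of_ne _ hne, slope_def_field, norm_div, Z1_one, one_mul,
    div_le_iff₀ (by linarith)]
  have hQ : (0 : ℝ) ≤ Q := Q.cast_nonneg
  have h1 : ‖Z1 z * χ.LFunction z - χ.LFunction 1‖ ≤ (|K| * (4 * Zc 1) + Zc 1) * Q := by
    refine (norm_sub_le _ _).trans ?_
    rw [norm_mul]
    have : ‖Z1 z‖ * ‖χ.LFunction z‖ ≤ |K| * (Q * 4 * Zc 1) := by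
      gcongr
      exact hL.trans (by gcongr)
    linarith
  refine h1.trans ?_
  calc (|K| * (4 * Zc 1) + Zc 1) * Q = (2 * (|K| * (4 * Zc 1) + Zc 1)) * Q * (1 / 2) := by ring
    _ ≤ _ := by
      gcongr
      exact le_max_right _ _

lemma iteratedDeriv_gF {Q : ℕ} [NeZero Q] {χ : DirichletCharacter ℂ Q} (m : ℕ) :
    iteratedDeriv m (gF χ) 2 = iteratedDeriv m (LSeries χ.zetaMul) 2 -
      χ.LFunction 1 * ((-1) ^ m * m.factorial) := by
  have hU : IsOpen {s : ℂ | 1 < s.re} := isOpen_lt continuous_const continuous_re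
  have h2 : (2 : ℂ) ∈ {s : ℂ | 1 < s.re} := by simp
  have he : Set.EqOn (gF χ) (fun s => LSeries χ.zetaMul s - χ.LFunction 1 * (s - 1)⁻¹)
      {s : ℂ | 1 < s.re} := by
    intro s hs
    have hs : 1 < s.re := hs
    simp only
    rw [LSeries_zetaMul χ hs, gF_apply χ (by rintro rfl; simp at hs)]
  rw [he.iteratedDeriv_of_isOpen hU m h2]
  have hA1 : AnalyticAt ℂ (LSeries χ.zetaMul) 2 := by
    have := LSeries_analyticOnNhd χ.zetaMul
    apply this
    simpa using abscissa_lt χ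
  have hA2 : AnalyticAt ℂ (fun s : ℂ => χ.LFunction 1 * (s - 1)⁻¹) 2 := by
    apply AnalyticAt.mul analyticAt_const
    apply AnalyticAt.inv (by fun_prop)
    norm_num
  have := iteratedDeriv_sub (n := m) (hA1.contDiffAt (n := m)) (hA2.contDiffAt (n := m))
  rw [show (fun s => LSeries χ.zetaMul s - χ.LFunction 1 * (s - 1)⁻¹) =
    LSeries χ.zetaMul - (fun s : ℂ => χ.LFunction 1 * (s - 1)⁻¹) from rfl, this]
  congr 1
  rw [iteratedDeriv_const_mul_field]
  congr 1
  have := iteratedDeriv_comp_sub_const m (fun s : ℂ => s⁻¹) 1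
  rw [this, iteratedDeriv_eq_iterate]
  have h3 := iter_deriv_inv (𝕜 := ℂ) m (2 - 1)
  refine Eq.trans h3 ?_
  norm_num

end NSM

end

section
open scoped ComplexOrder

namespace NSM

lemma taylor_lower {Q : ℕ} [NeZero Q] {χ : DirichletCharacter ℂ Q} (hχ : χ ≠ 1) (h2 : χ ^ 2 = 1)
    {B : ℝ} (hB0 : 0 ≤ B)
    (hB : ∀ z ∈ Metric.sphere (2 : ℂ) (3 / 2), ‖gF χ z‖ ≤ B * Q) {b : ℝ} (hb : 7 / 8 ≤ b)
    (hb1 : b < 1) (M : ℕ) (hM : 1 ≤ M) :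
    1 - (χ.LFunction 1).re * ∑ m ∈ Finset.range M, (2 - b) ^ m - 4 * (B * Q) * (3 / 4) ^ M ≤
      (gF χ b).re := by
  have hT := Complex.hasSum_taylorSeries_on_ball (f := gF χ) (c := 2) (r := 3 / 2)
    (gF_diff hχ).differentiableOn (z := (b : ℂ)) (by
      rw [Metric.mem_ball, dist_eq_norm, ← ofReal_ofNat, ← ofReal_sub, Complex.norm_real,
        Real.norm_eq_abs, abs_lt]; constructor <;> linarith)
  set u : ℕ → ℂ := fun n => ((n.factorial : ℂ))⁻¹ • ((b : ℂ) - 2) ^ n • iteratedDeriv n (gF χ) 2 with hu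
  have hbn : ‖(b : ℂ) - 2‖ ≤ 9 / 8 := by
    rw [← ofReal_ofNat, ← ofReal_sub, Complex.norm_real, Real.norm_eq_abs, abs_le]
    constructor <;> linarith
  have hun : ∀ n, ‖u n‖ ≤ (B * Q) * (3 / 4) ^ n := by
    intro n
    have h := Complex.norm_iteratedDeriv_le_of_forall_mem_sphere_norm_le n (by norm_num)
      (gF_diff hχ).diffContOnCl hB
    rw [hu]
    simp only [smul_eq_mul, norm_mul, norm_inv, norm_pow, Complex.norm_natCast]
    have hf : (0 : ℝ) < n.factorial := by exact_mod_cast n.factorial_pos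
    calc _ ≤ (n.factorial : ℝ)⁻¹ * ((9 / 8) ^ n * (n.factorial * (B * Q) / (3 / 2) ^ n)) := by
          gcongr
      _ = (B * Q) * ((9 / 8) / (3 / 2)) ^ n := by
          rw [div_pow (9 / 8 : ℝ) (3 / 2)]; field_simp
      _ = _ := by norm_num
  have hure : ∀ n, -((χ.LFunction 1).re * (2 - b) ^ n) ≤ (u n).re := by
    intro n
    have h := LSeries.iteratedDeriv_alternating (a := χ.zetaMul) (fun n => zetaMul_nonneg h2 n)
      (abscissa_lt χ) n
    have h3 := (Complex.le_def.1 h).1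
    have e : u n = (((2 - b) ^ n * (n.factorial : ℝ)⁻¹ : ℝ) : ℂ) *
        ((-1) ^ n * iteratedDeriv n (LSeries χ.zetaMul) ((2 : ℝ) : ℂ)) -
        (((2 - b) ^ n : ℝ) : ℂ) * χ.LFunction 1 := by
      have hf : (n.factorial : ℂ) ≠ 0 := by exact_mod_cast n.factorial_ne_zero
      have e2 : ((b : ℂ) - 2) ^ n = (-1) ^ n * (2 - b) ^ n := by
        rw [← mul_pow]; congr 1; ring
      have e3 : ((-1 : ℂ) ^ n) * (-1) ^ n = 1 := by rw [← mul_pow]; simp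
      rw [hu]
      simp only [smul_eq_mul]
      rw [iteratedDeriv_gF, e2]
      push_cast
      field_simp
      linear_combination (-((2 - (b : ℂ)) ^ n * χ.LFunction 1 * n.factorial)) * e3
    rw [e, sub_re, re_ofReal_mul, re_ofReal_mul]
    have : 0 ≤ ((2 - b) ^ n * (n.factorial : ℝ)⁻¹) *
        ((-1) ^ n * iteratedDeriv n (LSeries χ.zetaMul) ((2 : ℝ) : ℂ)).re := by
      apply mul_nonneg
      · have : 0 ≤ 2 - b := by linarith
        positivity
      · simpa using h3
    linarith
  have hu0 : 1 - (χ.LFunction 1).re ≤ (u 0).re := by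
    have : u 0 = LSeries χ.zetaMul 2 - χ.LFunction 1 := by
      rw [hu]; simp only [smul_eq_mul]; rw [iteratedDeriv_gF]; simp
    rw [this, sub_re]
    linarith [one_le_LSeries_two h2]
  have hsplit := hT.summable.sum_add_tsum_nat_add M
  rw [hT.tsum_eq] at hsplit
  have htail : ‖∑' i, u (i + M)‖ ≤ 4 * (B * Q) * (3 / 4) ^ M := by
    have hg : HasSum (fun i : ℕ => (B * Q) * (3 / 4) ^ M * (3 / 4 : ℝ) ^ i)
        ((B * Q) * (3 / 4) ^ M * (1 - 3 / 4)⁻¹) :=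
      (hasSum_geometric_of_lt_one (by norm_num) (by norm_num)).mul_left _
    refine (tsum_of_norm_bounded hg (fun i => (hun _).trans (le_of_eq ?_))).trans (le_of_eq ?_)
    · rw [pow_add]; ring
    · norm_num; ring
  have hhead : 1 - (χ.LFunction 1).re * ∑ m ∈ Finset.range M, (2 - b) ^ m ≤
      (∑ i ∈ Finset.range M, u i).re := by
    obtain ⟨M', rfl⟩ : ∃ M', M = M' + 1 := ⟨M - 1, by omega⟩
    rw [Finset.sum_range_succ', Finset.sum_range_succ', Complex.add_re, Complex.re_sum, mul_add,
      Finset.mul_sum]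
    have : ∑ i ∈ Finset.range M', -((χ.LFunction 1).re * (2 - b) ^ (i + 1)) ≤
        ∑ i ∈ Finset.range M', (u (i + 1)).re := Finset.sum_le_sum (fun i _ => hure _)
    rw [Finset.sum_neg_distrib] at this
    simp only [pow_zero, mul_one]
    linarith
  rw [← hsplit, add_re]
  have := (abs_le.1 ((Complex.abs_re_le_norm _).trans htail)).1
  linarith

/-- lower bound for real characters -/
lemma real_lower : ∃ c0 > (0 : ℝ), ∃ c > (0 : ℝ), ∀ (Q : ℕ) [NeZero Q] (χ : DirichletCharacter ℂ Q),
    χ ≠ 1 → χ ^ 2 = 1 → ∀ l : ℝ, 1 ≤ l → Real.log Q ≤ l →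
    (∀ x : ℝ, 1 - c0 / l ≤ x → χ.LFunction x ≠ 0) → c / l ≤ ‖χ.LFunction 1‖ := by
  obtain ⟨B, hB1, hB⟩ := gF_bound
  obtain ⟨δ, hδ, hZδ⟩ : ∃ δ > (0 : ℝ), ∀ x : ℝ, |x - 1| < δ → 0 < (Z1 x).re := by
    have hc : ContinuousAt (fun x : ℝ => (Z1 x).re) 1 :=
      (continuous_re.comp (Z1_diff.continuous.comp continuous_ofReal)).continuousAt
    have : ∀ᶠ x : ℝ in nhds 1, 0 < (Z1 x).re := hc.eventually (lt_mem_nhds (by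
      simp [Z1_one]))
    obtain ⟨δ, hδ, h⟩ := Metric.eventually_nhds_iff.1 this
    exact ⟨δ, hδ, fun x hx => h (by rwa [Real.dist_eq])⟩
  set c0 : ℝ := min (δ / 2) (1 / 8) with hc0
  have hc0p : 0 < c0 := by positivity
  set h43 : ℝ := Real.log (4 / 3) with hh43
  have h43p : 0 < h43 := Real.log_pos (by norm_num)
  set C1 : ℝ := Real.log (8 * B) / h43 + 1 / h43 + 1 with hC1
  refine ⟨c0, hc0p, c0 / (2 * Real.exp (C1 * c0)), by positivity, ?_⟩
  intro Q _ χ hχ h2 l hl hQl hne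
  have hl0 : 0 < l := by linarith
  have hQ1 : (1 : ℝ) ≤ Q := by exact_mod_cast NeZero.one_le
  set b : ℝ := 1 - c0 / l with hb
  have hd0 : 0 < c0 / l := by positivity
  have hdc : c0 / l ≤ c0 := div_le_self hc0p.le hl
  have hc08 : c0 ≤ 1 / 8 := min_le_right _ _
  have hc0δ : c0 ≤ δ / 2 := min_le_left _ _
  have hLb : 0 < (χ.LFunction b).re :=
    LFunction_pos_of_ne hχ h2 (by linarith) hne le_rfl (by linarith)
  have hL1 : 0 < (χ.LFunction 1).re := by
    have := LFunction_pos_of_ne hχ h2 (b := b) (by linarith) hne (x := 1) (by linarith) (by norm_num)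
    simpa using this
  set Λ := (χ.LFunction 1).re with hΛ
  have hlog8 : 0 ≤ Real.log (8 * B) := Real.log_nonneg (by linarith)
  have hlog8Q : 0 < Real.log (8 * B * Q) := Real.log_pos (by nlinarith)
  set M : ℕ := ⌈Real.log (8 * B * Q) / h43⌉₊ with hM
  have hM1 : 1 ≤ M := Nat.one_le_ceil_iff.2 (by positivity)
  have hMlow : Real.log (8 * B * Q) ≤ M * h43 := by
    rw [← div_le_iff₀ h43p]; exact Nat.le_ceil _
  have hMup : (M : ℝ) ≤ C1 * l := by
    have h1 : (M : ℝ) ≤ Real.log (8 * B * Q) / h43 + 1 := (Nat.ceil_lt_add_one (by positivity)).le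
    rw [Real.log_mul (by positivity) (by positivity), add_div] at h1
    have h3 : Real.log Q / h43 ≤ l / h43 := by gcongr
    have h4 : Real.log (8 * B) / h43 ≤ Real.log (8 * B) / h43 * l :=
      le_mul_of_one_le_right (by positivity) hl
    calc (M : ℝ) ≤ Real.log (8 * B) / h43 * l + l / h43 + l := by linarith
      _ = C1 * l := by rw [hC1]; ring
  have hpow : 4 * (B * Q) * (3 / 4 : ℝ) ^ M ≤ 1 / 2 := by
    have h1 : 8 * B * Q ≤ (4 / 3 : ℝ) ^ M := by
      rw [← Real.log_le_log_iff (by positivity) (by positivity), Real.log_pow]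
      exact hMlow
    have h3 : (3 / 4 : ℝ) ^ M * (4 / 3) ^ M = 1 := by rw [← mul_pow]; norm_num
    have h4 : (0 : ℝ) < (3 / 4 : ℝ) ^ M := by positivity
    nlinarith
  have hT := taylor_lower hχ h2 (by linarith) (hB Q χ hχ) (b := b) (by linarith) (by linarith) M hM1
  have hbne : (b : ℂ) ≠ 1 := by
    intro h
    have : b = 1 := by exact_mod_cast h
    linarith
  have hLbim : (χ.LFunction b).im = 0 := LFunction_im hχ h2 (by linarith)
  have hb1 : b - 1 < 0 := by linarith
  have hzeta : (riemannZeta b).re < 0 := by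
    have h1 := hZδ b (by rw [abs_lt]; constructor <;> linarith)
    rw [Z1_apply hbne] at h1
    rw [show ((b : ℂ) - 1) = ((b - 1 : ℝ) : ℂ) by push_cast; rfl, re_ofReal_mul] at h1
    by_contra hc
    push Not at hc
    have := mul_nonpos_of_nonpos_of_nonneg hb1.le hc
    linarith
  have hgb : (gF χ b).re ≤ Λ * (c0 / l)⁻¹ := by
    rw [gF_apply χ hbne, sub_re, mul_re, hLbim]
    rw [show ((b : ℂ) - 1)⁻¹ = (((b - 1)⁻¹ : ℝ) : ℂ) by push_cast; rfl, mul_comm (χ.LFunction 1),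
      re_ofReal_mul]
    have h1 : (riemannZeta b).re * (χ.LFunction b).re ≤ 0 :=
      mul_nonpos_of_nonpos_of_nonneg hzeta.le hLb.le
    have h3 : (b - 1)⁻¹ = - (c0 / l)⁻¹ := by
      rw [hb, show 1 - c0 / l - 1 = -(c0 / l) by ring, inv_neg]
    rw [h3]
    linarith
  have hgeom : ∑ m ∈ Finset.range M, (2 - b) ^ m = ((2 - b) ^ M - 1) * (c0 / l)⁻¹ := by
    rw [geom_sum_eq (by linarith), div_eq_mul_inv]
    congr 2
    rw [hb]; ring
  rw [hgeom] at hT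
  have hexp : (2 - b) ^ M ≤ Real.exp (C1 * c0) := by
    have h1 : 2 - b ≤ Real.exp (c0 / l) := by
      have := Real.add_one_le_exp (c0 / l)
      linarith
    calc (2 - b) ^ M ≤ (Real.exp (c0 / l)) ^ M := by
          gcongr; linarith
      _ = Real.exp (M * (c0 / l)) := by rw [← Real.exp_nat_mul]
      _ ≤ Real.exp (C1 * l * (c0 / l)) := by gcongr
      _ = _ := by congr 1; field_simp
  have hfin : 1 / 2 ≤ Λ * (2 - b) ^ M * (c0 / l)⁻¹ := by
    have : Λ * (((2 - b) ^ M - 1) * (c0 / l)⁻¹) = Λ * (2 - b) ^ M * (c0 / l)⁻¹ - Λ * (c0 / l)⁻¹ := by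
      ring
    linarith
  have hfin2 : 1 / 2 * (c0 / l) ≤ Λ * Real.exp (C1 * c0) := by
    calc 1 / 2 * (c0 / l) ≤ Λ * (2 - b) ^ M * (c0 / l)⁻¹ * (c0 / l) := by gcongr
      _ = Λ * (2 - b) ^ M := by field_simp
      _ ≤ _ := by gcongr
  refine le_trans ?_ (Complex.re_le_norm _)
  have hE := Real.exp_pos (C1 * c0)
  calc c0 / (2 * Real.exp (C1 * c0)) / l = (1 / 2 * (c0 / l)) / Real.exp (C1 * c0) := by
        field_simp
    _ ≤ Λ := by rw [div_le_iff₀ hE]; exact hfin2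

end NSM

end

namespace NSM

lemma divisor_bound {ε : ℝ} (hε : 0 < ε) :
    ∃ C : ℝ, 1 ≤ C ∧ ∀ m : ℕ, m ≠ 0 → (m.divisors.card : ℝ) ≤ C * (m : ℝ) ^ ε := by
  obtain ⟨N, hN⟩ := exists_nat_ge ((2 : ℝ) ^ (1 / ε))
  have hl2 : 0 < Real.log 2 := Real.log_pos (by norm_num)
  set K : ℝ := max 1 (1 / (ε * Real.log 2)) with hK
  have hK1 : 1 ≤ K := le_max_left _ _
  have hK2 : 1 ≤ K * (ε * Real.log 2) := by
    have h : 1 / (ε * Real.log 2) ≤ K := le_max_right _ _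
    rwa [div_le_iff₀ (by positivity)] at h
  refine ⟨K ^ N, one_le_pow₀ hK1, fun m hm => ?_⟩
  have key : ∀ p ∈ m.primeFactors, ((m.factorization p + 1 : ℕ) : ℝ) ≤
      (if p < N then K else 1) * ((p : ℝ) ^ (m.factorization p)) ^ ε := by
    intro p hp
    have hpp : p.Prime := Nat.prime_of_mem_primeFactors hp
    have hp2 : (2 : ℝ) ≤ p := by exact_mod_cast hpp.two_le
    set a := m.factorization p
    have e1 : ((p : ℝ) ^ a) ^ ε = ((p : ℝ) ^ ε) ^ a := by
      rw [← Real.rpow_natCast, ← Real.rpow_mul (by positivity), ← Real.rpow_natCast,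
        ← Real.rpow_mul (by positivity), mul_comm]
    split_ifs with h
    · have h2 : (2 : ℝ) ^ ε ≤ (p : ℝ) ^ ε := Real.rpow_le_rpow (by norm_num) hp2 hε.le
      have h3 : 1 + a * (ε * Real.log 2) ≤ ((p : ℝ) ^ a) ^ ε := by
        rw [e1]
        calc 1 + a * (ε * Real.log 2) ≤ Real.exp (a * (ε * Real.log 2)) := by
              linarith [Real.add_one_le_exp (a * (ε * Real.log 2))]
          _ = ((2 : ℝ) ^ ε) ^ a := by
              rw [Real.rpow_def_of_pos (by norm_num), ← Real.exp_nat_mul]; ring_nf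
          _ ≤ _ := by gcongr
      calc ((a + 1 : ℕ) : ℝ) = a * 1 + 1 := by push_cast; ring
        _ ≤ a * (K * (ε * Real.log 2)) + K := by gcongr
        _ = K * (1 + a * (ε * Real.log 2)) := by ring
        _ ≤ _ := by gcongr
    · rw [one_mul, e1]
      have h2 : (2 : ℝ) ≤ (p : ℝ) ^ ε := by
        have h3 : (2 : ℝ) ^ (1 / ε) ≤ p := hN.trans (by exact_mod_cast not_lt.1 h)
        calc (2 : ℝ) = ((2 : ℝ) ^ (1 / ε)) ^ ε := by
              rw [← Real.rpow_mul (by norm_num), one_div_mul_cancel hε.ne', Real.rpow_one]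
          _ ≤ _ := Real.rpow_le_rpow (by positivity) h3 hε.le
      calc ((a + 1 : ℕ) : ℝ) ≤ (2 : ℝ) ^ a := by exact_mod_cast Nat.lt_two_pow_self
        _ ≤ _ := by gcongr
  have hg : ∏ p ∈ m.primeFactors, (if p < N then K else 1) ≤ K ^ N := by
    rw [Finset.prod_ite, Finset.prod_const, Finset.prod_const_one, mul_one]
    apply pow_le_pow_right₀ hK1
    calc _ ≤ (Finset.range N).card := Finset.card_le_card (by
            intro x hx; simp at hx ⊢; exact hx.2)
      _ = N := Finset.card_range N
  calc (m.divisors.card : ℝ) = ∏ p ∈ m.primeFactors, ((m.factorization p + 1 : ℕ) : ℝ) := by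
        rw [Nat.card_divisors hm]; push_cast; rfl
    _ ≤ ∏ p ∈ m.primeFactors, ((if p < N then K else 1) * ((p : ℝ) ^ (m.factorization p)) ^ ε) :=
        Finset.prod_le_prod (fun _ _ => by positivity) key
    _ = (∏ p ∈ m.primeFactors, (if p < N then K else 1)) * (m : ℝ) ^ ε := by
        rw [Finset.prod_mul_distrib, Real.finsetProd_rpow _ _ (fun _ _ => by positivity)]
        congr 2
        have := Nat.prod_factorization_pow_eq_self hm
        conv_rhs => rw [← this]
        rw [Finsupp.prod]; push_cast; rfl
    _ ≤ _ := by gcongr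

lemma plancherel {Q : ℕ} [NeZero Q] (c : ZMod Q → ℂ) :
    ∑ χ : DirichletCharacter ℂ Q, ‖∑ r, χ r * c r‖ ^ 2 ≤ Q * ∑ r, ‖c r‖ ^ 2 := by
  have orth : ∀ r s : ZMod Q, ∑ χ : DirichletCharacter ℂ Q, χ r * (starRingEnd ℂ) (χ s) =
      if r = s ∧ IsUnit s then (Q.totient : ℂ) else 0 := by
    intro r s
    by_cases hs : IsUnit s
    · have := DirichletCharacter.sum_char_inv_mul_char_eq ℂ hs r
      simp only [hs, and_true]
      refine Eq.trans ?_ (this.trans (if_congr eq_comm rfl rfl))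
      refine Finset.sum_congr rfl fun χ _ => ?_
      rw [mul_comm]
      congr 1
      have h1 : (starRingEnd ℂ) (χ s) = χ⁻¹ s := by
        rw [← MulChar.star_apply']; rfl
      rw [h1]
      obtain ⟨u, rfl⟩ := hs
      rw [MulChar.inv_apply, Ring.inverse_unit, ZMod.inv_coe_unit]
    · simp only [hs, and_false, if_false]
      exact Finset.sum_eq_zero fun χ _ => by simp [MulChar.map_nonunit χ hs]
  have main : ((∑ χ : DirichletCharacter ℂ Q, ‖∑ r, χ r * c r‖ ^ 2 : ℝ) : ℂ) =
      ∑ r : ZMod Q, if IsUnit r then (Q.totient : ℂ) * (‖c r‖ ^ 2 : ℝ) else 0 := by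
    push_cast
    calc _ = ∑ χ : DirichletCharacter ℂ Q, ∑ r, ∑ s, (c r * (starRingEnd ℂ) (c s)) *
            (χ r * (starRingEnd ℂ) (χ s)) := by
          refine Finset.sum_congr rfl fun χ _ => ?_
          rw [← Complex.mul_conj', map_sum, Finset.sum_mul_sum]
          refine Finset.sum_congr rfl fun r _ => Finset.sum_congr rfl fun s _ => ?_
          rw [map_mul]; ring
      _ = ∑ r, ∑ s, (c r * (starRingEnd ℂ) (c s)) *
            (if r = s ∧ IsUnit s then (Q.totient : ℂ) else 0) := by
          rw [Finset.sum_comm]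
          refine Finset.sum_congr rfl fun r _ => ?_
          rw [Finset.sum_comm]
          refine Finset.sum_congr rfl fun s _ => ?_
          rw [← Finset.mul_sum, orth]
      _ = _ := by
          refine Finset.sum_congr rfl fun r _ => ?_
          rw [Finset.sum_eq_single r]
          · by_cases h : IsUnit r
            · simp [h, Complex.mul_conj']; ring
            · simp [h]
          · intro s _ hs; simp [Ne.symm hs]
          · simp
  have main2 : (∑ χ : DirichletCharacter ℂ Q, ‖∑ r, χ r * c r‖ ^ 2 : ℝ) =
      ∑ r : ZMod Q, if IsUnit r then (Q.totient : ℝ) * (‖c r‖ ^ 2 : ℝ) else 0 := by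
    apply Complex.ofReal_injective
    rw [main]
    push_cast
    refine Finset.sum_congr rfl fun r _ => ?_
    split_ifs <;> simp
  rw [main2, Finset.mul_sum]
  refine Finset.sum_le_sum fun r _ => ?_
  split_ifs
  · have : (Q.totient : ℝ) ≤ Q := by exact_mod_cast Nat.totient_le Q
    gcongr
  · positivity

lemma plancherel_nat {Q : ℕ} [NeZero Q] (S : Finset ℕ) (a : ℕ → ℂ) :
    ∑ χ : DirichletCharacter ℂ Q, ‖∑ m ∈ S, χ (m : ZMod Q) * a m‖ ^ 2 ≤
      Q * ∑ r : ZMod Q, ‖∑ m ∈ S.filter (fun m : ℕ => (m : ZMod Q) = r), a m‖ ^ 2 := by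
  have := plancherel (Q := Q) (fun r => ∑ m ∈ S.filter (fun m : ℕ => (m : ZMod Q) = r), a m)
  refine le_trans (le_of_eq ?_) this
  refine Finset.sum_congr rfl fun χ _ => ?_
  congr 2
  rw [← Finset.sum_fiberwise S (fun m : ℕ => (m : ZMod Q))]
  refine Finset.sum_congr rfl fun r _ => ?_
  rw [Finset.mul_sum]
  refine Finset.sum_congr rfl fun m hm => ?_
  rw [(Finset.mem_filter.1 hm).2]

end NSM

namespace NSM

/-- The mollifier. -/
noncomputable def MM {Q : ℕ} (χ : DirichletCharacter ℂ Q) : ℂ :=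
  ∑ d ∈ Finset.Icc 1 Q, χ (d : ZMod Q) * ((ArithmeticFunction.moebius d : ℂ) / d)

/-- Partial sum of the L-function at one. -/
noncomputable def LN {Q : ℕ} (χ : DirichletCharacter ℂ Q) (N : ℕ) : ℂ :=
  ∑ e ∈ Finset.Icc 1 N, χ (e : ZMod Q) * (e : ℂ)⁻¹

/-- Coefficients of the mollified partial sum. -/
noncomputable def aco (Q N m : ℕ) : ℂ :=
  ∑ x ∈ (Finset.Icc 1 Q ×ˢ Finset.Icc 1 N).filter (fun x : ℕ × ℕ => x.1 * x.2 = m),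
    (ArithmeticFunction.moebius x.1 : ℂ)

lemma norm_moebius_le (d : ℕ) : ‖(ArithmeticFunction.moebius d : ℂ)‖ ≤ 1 := by
  rw [Complex.norm_intCast]
  exact_mod_cast ArithmeticFunction.abs_moebius_le_one (n := d)

lemma aco_norm (Q N m : ℕ) (hm : m ≠ 0) : ‖aco Q N m‖ ≤ m.divisors.card := by
  have hc : m.divisorsAntidiagonal.card = m.divisors.card := by
    rw [← Nat.map_div_right_divisors, Finset.card_map]
  calc ‖aco Q N m‖ ≤ ∑ x ∈ (Finset.Icc 1 Q ×ˢ Finset.Icc 1 N).filter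
          (fun x : ℕ × ℕ => x.1 * x.2 = m), (1 : ℝ) :=
        norm_sum_le_of_le _ fun x _ => norm_moebius_le _
    _ = ((Finset.Icc 1 Q ×ˢ Finset.Icc 1 N).filter (fun x : ℕ × ℕ => x.1 * x.2 = m)).card := by
        simp
    _ ≤ m.divisorsAntidiagonal.card := by
        norm_cast
        apply Finset.card_le_card
        intro x hx
        rw [Nat.mem_divisorsAntidiagonal]
        exact ⟨(Finset.mem_filter.1 hx).2, hm⟩
    _ = _ := by rw [hc]

lemma aco_small (Q N m : ℕ) (hm : 1 ≤ m) (hmQ : m ≤ Q) (hQN : Q ≤ N) :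
    aco Q N m = if m = 1 then 1 else 0 := by
  have : (Finset.Icc 1 Q ×ˢ Finset.Icc 1 N).filter (fun x : ℕ × ℕ => x.1 * x.2 = m) =
      m.divisorsAntidiagonal := by
    ext ⟨a, b⟩
    simp only [Finset.mem_filter, Finset.mem_product, Finset.mem_Icc, Nat.mem_divisorsAntidiagonal]
    constructor
    · rintro ⟨_, h⟩; exact ⟨h, by omega⟩
    · rintro ⟨h, h0⟩
      have ha : 0 < a := Nat.pos_of_ne_zero (by rintro rfl; simp at h; omega)
      have hb : 0 < b := Nat.pos_of_ne_zero (by rintro rfl; simp at h; omega)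
      have h1 : a ≤ m := h ▸ Nat.le_mul_of_pos_right a hb
      have h2 : b ≤ m := h ▸ Nat.le_mul_of_pos_left b ha
      exact ⟨⟨⟨ha, by omega⟩, ⟨hb, by omega⟩⟩, h⟩
  have h2 := congrArg (fun f => f m) ArithmeticFunction.moebius_mul_coe_zeta
  simp only [ArithmeticFunction.mul_apply, ArithmeticFunction.one_apply] at h2
  rw [aco, this]
  have h3 : ∑ x ∈ m.divisorsAntidiagonal, ArithmeticFunction.moebius x.1 =
      if m = 1 then 1 else 0 := by
    rw [← h2]
    refine Finset.sum_congr rfl fun x hx => ?_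
    have h := Nat.mem_divisorsAntidiagonal.1 hx
    have : x.2 ≠ 0 := by rintro h0; rw [h0] at h; simp at h; omega
    simp [ArithmeticFunction.natCoe_apply, ArithmeticFunction.zeta_apply, this]
  have h4 := congrArg (fun z : ℤ => (z : ℂ)) h3
  simp only [Int.cast_sum] at h4
  rw [h4]
  split_ifs <;> simp

lemma LN_mul_MM {Q : ℕ} [NeZero Q] (χ : DirichletCharacter ℂ Q) (N : ℕ) (hQN : Q ≤ N) :
    LN χ N * MM χ - 1 =
      ∑ m ∈ Finset.Ioc Q (Q * N), χ (m : ZMod Q) * (aco Q N m / m) := by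
  have hQ : 1 ≤ Q := Nat.one_le_iff_ne_zero.2 (NeZero.ne Q)
  have h1 : LN χ N * MM χ = ∑ m ∈ Finset.Icc 1 (Q * N), χ (m : ZMod Q) * (aco Q N m / m) := by
    rw [mul_comm, LN, MM, Finset.sum_mul_sum, ← Finset.sum_product',
      ← Finset.sum_fiberwise_of_maps_to (g := fun x : ℕ × ℕ => x.1 * x.2)
        (t := Finset.Icc 1 (Q * N))]
    · refine Finset.sum_congr rfl fun m hm => ?_
      rw [aco, Finset.sum_div, Finset.mul_sum]
      refine Finset.sum_congr rfl fun x hx => ?_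
      have hx2 := (Finset.mem_filter.1 hx).2
      rw [← hx2]
      push_cast
      rw [map_mul, div_eq_mul_inv, div_eq_mul_inv, mul_inv]
      ring
    · intro x hx
      simp only [Finset.mem_product, Finset.mem_Icc] at hx ⊢
      exact ⟨Nat.mul_pos hx.1.1 hx.2.1, Nat.mul_le_mul hx.1.2 hx.2.2⟩
  have h2 : Finset.Icc 1 (Q * N) = Finset.Icc 1 Q ∪ Finset.Ioc Q (Q * N) := by
    ext x
    simp only [Finset.mem_union, Finset.mem_Icc, Finset.mem_Ioc]
    have : Q ≤ Q * N := Nat.le_mul_of_pos_right Q (by omega)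
    omega
  have h3 : Disjoint (Finset.Icc 1 Q) (Finset.Ioc Q (Q * N)) := by
    rw [Finset.disjoint_left]; intro x hx hx'
    simp only [Finset.mem_Icc, Finset.mem_Ioc] at hx hx'
    omega
  rw [h1, h2, Finset.sum_union h3]
  have h4 : ∑ m ∈ Finset.Icc 1 Q, χ (m : ZMod Q) * (aco Q N m / m) = 1 := by
    rw [Finset.sum_eq_single 1]
    · rw [aco_small Q N 1 le_rfl hQ hQN]; simp
    · intro m hm hm1
      rw [Finset.mem_Icc] at hm
      rw [aco_small Q N m hm.1 hm.2 hQN]; simp [hm1]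
    · intro h; exact absurd (Finset.mem_Icc.2 ⟨le_rfl, hQ⟩) h
  rw [h4]; ring

lemma LN_approx {Q : ℕ} [NeZero Q] {χ : DirichletCharacter ℂ Q} (hχ : χ ≠ 1) (N : ℕ) :
    ‖χ.LFunction 1 - LN χ N‖ ≤ 2 * Q / (N + 1) := by
  have := LFunction_one_sub_partial hχ N
  convert this using 3
  rw [LN, Finset.range_eq_Ico, ← Finset.Ico_succ_right_eq_Icc]
  have := Finset.sum_Ico_add' (fun e : ℕ => χ (e : ZMod Q) * (e : ℂ)⁻¹) 0 N 1
  simp only [zero_add] at this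
  rw [show Order.succ N = N + 1 from rfl, ← this]
  push_cast
  rfl

lemma MM_le {Q : ℕ} (χ : DirichletCharacter ℂ Q) : ‖MM χ‖ ≤ Q := by
  calc ‖MM χ‖ ≤ ∑ d ∈ Finset.Icc 1 Q, (1 : ℝ) := by
        refine norm_sum_le_of_le _ fun d hd => ?_
        have hd1 : (1 : ℝ) ≤ d := by exact_mod_cast (Finset.mem_Icc.1 hd).1
        rw [norm_mul, norm_div, Complex.norm_natCast]
        have h1 : ‖χ (d : ZMod Q)‖ ≤ 1 := χ.norm_le_one _
        have h2 : ‖(ArithmeticFunction.moebius d : ℂ)‖ / d ≤ 1 :=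
          div_le_one_of_le₀ ((norm_moebius_le d).trans hd1) (by positivity)
        exact mul_le_one₀ h1 (by positivity) h2
    _ = Q := by simp

lemma sum_MM_sq : ∃ C > (0 : ℝ), ∀ (Q : ℕ) [NeZero Q],
    ∑ χ : DirichletCharacter ℂ Q, ‖MM χ‖ ^ 2 ≤ C * Q := by
  have hs : Summable (fun n : ℕ => ((n : ℝ) ^ 2)⁻¹) := by
    simp
  refine ⟨(∑' n : ℕ, ((n : ℝ) ^ 2)⁻¹) + 1, ?_, ?_⟩
  · have : 0 ≤ ∑' n : ℕ, ((n : ℝ) ^ 2)⁻¹ := tsum_nonneg fun n => by positivity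
    linarith
  intro Q _
  have h := plancherel_nat (Q := Q) (Finset.Icc 1 Q)
    (fun d => (ArithmeticFunction.moebius d : ℂ) / d)
  refine h.trans ?_
  rw [mul_comm]
  gcongr
  calc _ ≤ ∑ r : ZMod Q, ∑ d ∈ (Finset.Icc 1 Q).filter (fun m : ℕ => (m : ZMod Q) = r),
          ((d : ℝ) ^ 2)⁻¹ := by
        refine Finset.sum_le_sum fun r _ => ?_
        have hc : ((Finset.Icc 1 Q).filter (fun m : ℕ => (m : ZMod Q) = r)).card ≤ 1 := by
          rw [Finset.card_le_one]
          intro a ha b hb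
          simp only [Finset.mem_filter, Finset.mem_Icc] at ha hb
          have hab : (a : ZMod Q) = b := ha.2.trans hb.2.symm
          rw [ZMod.natCast_eq_natCast_iff] at hab
          have := Nat.ModEq.dvd hab
          obtain ⟨t, ht⟩ := this
          have hQ : (0 : ℤ) < Q := by exact_mod_cast Nat.pos_of_ne_zero (NeZero.ne Q)
          have h1 : t < 1 := by
            by_contra hh; push Not at hh; nlinarith
          have h2 : -1 < t := by
            by_contra hh; push Not at hh; nlinarith
          have : t = 0 := by omega
          subst this; omega
        rcases Finset.card_le_one_iff_subset_singleton.1 hc with ⟨x, hx⟩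
        rcases Finset.subset_singleton_iff.1 hx with h0 | h0
        · rw [h0]; simp
        · rw [h0, Finset.sum_singleton, Finset.sum_singleton, norm_div, div_pow,
            Complex.norm_natCast, div_eq_mul_inv]
          have := norm_moebius_le x
          have h2 : ‖(ArithmeticFunction.moebius x : ℂ)‖ ^ 2 ≤ 1 := pow_le_one₀ (norm_nonneg _) this
          calc _ ≤ 1 * ((x : ℝ) ^ 2)⁻¹ := by gcongr
            _ = _ := one_mul _
    _ = ∑ d ∈ Finset.Icc 1 Q, ((d : ℝ) ^ 2)⁻¹ := Finset.sum_fiberwise _ _ _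
    _ ≤ ∑' n : ℕ, ((n : ℝ) ^ 2)⁻¹ := hs.sum_le_tsum _ fun n _ => by positivity
    _ ≤ _ := by linarith

end NSM

namespace NSM

lemma sum_err_sq : ∃ C > (0 : ℝ), ∀ (Q : ℕ) [NeZero Q],
    ∑ χ : DirichletCharacter ℂ Q, ‖LN χ (Q ^ 3) * MM χ - 1‖ ^ 2 ≤ C * (Q : ℝ) ^ (1 / 2 : ℝ) := by
  obtain ⟨D, hD1, hD⟩ := divisor_bound (ε := 1 / 32) (by norm_num)
  have hs : Summable (fun n : ℕ => (n : ℝ) ^ (-(33 / 32) : ℝ)) := by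
    rw [Real.summable_nat_rpow]; norm_num
  set Z : ℝ := ∑' n : ℕ, (n : ℝ) ^ (-(33 / 32) : ℝ) with hZ
  have hZ0 : 0 ≤ Z := tsum_nonneg fun n => by positivity
  refine ⟨D ^ 2 * Z ^ 2 + 1, by positivity, ?_⟩
  intro Q _
  have hQ1 : 1 ≤ Q := Nat.one_le_iff_ne_zero.2 (NeZero.ne Q)
  have hQr : (1 : ℝ) ≤ Q := by exact_mod_cast hQ1
  have hQN : Q ≤ Q ^ 3 := Nat.le_self_pow (by norm_num) Q
  have h := plancherel_nat (Q := Q) (Finset.Ioc Q (Q * Q ^ 3))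
    (fun m => aco Q (Q ^ 3) m / m)
  have e : ∑ χ : DirichletCharacter ℂ Q, ‖LN χ (Q ^ 3) * MM χ - 1‖ ^ 2 =
      ∑ χ : DirichletCharacter ℂ Q, ‖∑ m ∈ Finset.Ioc Q (Q * Q ^ 3),
        χ (m : ZMod Q) * (aco Q (Q ^ 3) m / m)‖ ^ 2 :=
    Finset.sum_congr rfl fun χ _ => by rw [LN_mul_MM χ (Q ^ 3) hQN]
  rw [e]
  refine h.trans ?_
  have key : ∀ r : ZMod Q, ‖∑ m ∈ (Finset.Ioc Q (Q * Q ^ 3)).filter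
      (fun m : ℕ => (m : ZMod Q) = r), aco Q (Q ^ 3) m / m‖ ≤
      D * (Q : ℝ) ^ (1 / 4 : ℝ) * (Q : ℝ)⁻¹ * Z := by
    intro r
    set S := (Finset.Ioc Q (Q * Q ^ 3)).filter (fun m : ℕ => (m : ZMod Q) = r) with hS
    have hterm : ∀ m ∈ S, ‖aco Q (Q ^ 3) m / m‖ ≤
        D * (Q : ℝ) ^ (1 / 4 : ℝ) * (Q : ℝ)⁻¹ * ((m / Q : ℕ) : ℝ) ^ (-(33 / 32) : ℝ) := by
      intro m hm
      simp only [hS, Finset.mem_filter, Finset.mem_Ioc] at hm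
      have hm0 : 0 < m := by omega
      have hmr : (0 : ℝ) < m := by exact_mod_cast hm0
      have hd : 1 ≤ m / Q := (Nat.one_le_div_iff (by omega)).2 hm.1.1.le
      have hdr : (1 : ℝ) ≤ ((m / Q : ℕ) : ℝ) := by exact_mod_cast hd
      have h1 : ((m / Q : ℕ) : ℝ) * Q ≤ m := by exact_mod_cast Nat.div_mul_le_self m Q
      have h2 : (m : ℝ) ^ (-(33 / 32) : ℝ) ≤ ((m / Q : ℕ) : ℝ) ^ (-(33 / 32) : ℝ) * (Q : ℝ)⁻¹ := by
        calc (m : ℝ) ^ (-(33 / 32) : ℝ) ≤ (((m / Q : ℕ) : ℝ) * Q) ^ (-(33 / 32) : ℝ) :=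
              Real.rpow_le_rpow_of_nonpos (by positivity) h1 (by norm_num)
          _ = ((m / Q : ℕ) : ℝ) ^ (-(33 / 32) : ℝ) * (Q : ℝ) ^ (-(33 / 32) : ℝ) :=
              Real.mul_rpow (by positivity) (by positivity)
          _ ≤ ((m / Q : ℕ) : ℝ) ^ (-(33 / 32) : ℝ) * (Q : ℝ) ^ (-1 : ℝ) := by
              gcongr
              · norm_num
          _ = _ := by rw [Real.rpow_neg_one]
      have h3 : (m : ℝ) ^ (1 / 16 : ℝ) ≤ (Q : ℝ) ^ (1 / 4 : ℝ) := by
        have : (m : ℝ) ≤ (Q : ℝ) ^ (4 : ℝ) := by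
          have : (m : ℝ) ≤ Q * Q ^ 3 := by exact_mod_cast hm.1.2
          rw [show (4 : ℝ) = (4 : ℕ) by norm_num, Real.rpow_natCast]
          calc _ ≤ _ := this
            _ = _ := by ring
        calc (m : ℝ) ^ (1 / 16 : ℝ) ≤ ((Q : ℝ) ^ (4 : ℝ)) ^ (1 / 16 : ℝ) :=
              Real.rpow_le_rpow (by positivity) this (by norm_num)
          _ = _ := by rw [← Real.rpow_mul (by positivity)]; norm_num
      have h4 : (m : ℝ) ^ (1 / 32 : ℝ) / m = (m : ℝ) ^ (1 / 16 : ℝ) * (m : ℝ) ^ (-(33 / 32) : ℝ) := by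
        rw [← Real.rpow_add hmr, ← Real.rpow_sub_one hmr.ne']; norm_num
      rw [norm_div, Complex.norm_natCast]
      calc ‖aco Q (Q ^ 3) m‖ / m ≤ (D * (m : ℝ) ^ (1 / 32 : ℝ)) / m := by
            gcongr
            exact (aco_norm Q (Q ^ 3) m hm0.ne').trans (hD m hm0.ne')
        _ = D * ((m : ℝ) ^ (1 / 16 : ℝ) * (m : ℝ) ^ (-(33 / 32) : ℝ)) := by
            rw [mul_div_assoc, h4]
        _ ≤ D * ((Q : ℝ) ^ (1 / 4 : ℝ) * (((m / Q : ℕ) : ℝ) ^ (-(33 / 32) : ℝ) * (Q : ℝ)⁻¹)) := by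
            gcongr
        _ = _ := by ring
    have hinj : Set.InjOn (fun m : ℕ => m / Q) S := by
      intro a ha b hb hab
      simp only [hS, Finset.coe_filter, Finset.mem_Ioc, Set.mem_setOf_eq] at ha hb
      have h1 : (a : ZMod Q) = b := ha.2.trans hb.2.symm
      rw [ZMod.natCast_eq_natCast_iff'] at h1
      simp only at hab
      rw [← Nat.div_add_mod a Q, ← Nat.div_add_mod b Q, h1, hab]
    calc _ ≤ ∑ m ∈ S, D * (Q : ℝ) ^ (1 / 4 : ℝ) * (Q : ℝ)⁻¹ *
          ((m / Q : ℕ) : ℝ) ^ (-(33 / 32) : ℝ) := norm_sum_le_of_le _ hterm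
      _ = D * (Q : ℝ) ^ (1 / 4 : ℝ) * (Q : ℝ)⁻¹ *
          ∑ n ∈ S.image (fun m : ℕ => m / Q), (n : ℝ) ^ (-(33 / 32) : ℝ) := by
          rw [← Finset.mul_sum, Finset.sum_image hinj]
      _ ≤ _ := by
          gcongr
          exact hs.sum_le_tsum _ fun n _ => by positivity
  have hq : ((Q : ℝ) ^ (1 / 4 : ℝ)) ^ 2 = (Q : ℝ) ^ (1 / 2 : ℝ) := by
    rw [← Real.rpow_natCast, ← Real.rpow_mul (by positivity)]; norm_num
  calc _ ≤ (Q : ℝ) * ∑ r : ZMod Q, (D * (Q : ℝ) ^ (1 / 4 : ℝ) * (Q : ℝ)⁻¹ * Z) ^ 2 := by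
        gcongr with r _
        exact key r
    _ = D ^ 2 * Z ^ 2 * (Q : ℝ) ^ (1 / 2 : ℝ) := by
        rw [Finset.sum_const, Finset.card_univ, ZMod.card, nsmul_eq_mul]
        simp only [mul_pow]
        rw [hq]
        field_simp
    _ ≤ _ := by
        gcongr
        linarith

open scoped Classical in
/-- The set of characters at which the mollifier is bad. -/
noncomputable def bad (Q : ℕ) [NeZero Q] : Finset (DirichletCharacter ℂ Q) :=
  Finset.univ.filter (fun χ => χ ≠ 1 ∧ 1 / 2 ≤ ‖χ.LFunction 1 * MM χ - 1‖)

lemma card_char_le (Q : ℕ) [NeZero Q] : Fintype.card (DirichletCharacter ℂ Q) ≤ Q := by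
  have := DirichletCharacter.card_eq_totient_of_hasEnoughRootsOfUnity ℂ Q
  rw [← Nat.card_eq_fintype_card, this]
  exact Nat.totient_le Q

lemma card_bad : ∃ C > (0 : ℝ), ∀ (Q : ℕ) [NeZero Q],
    ((bad Q).card : ℝ) ≤ C * (Q : ℝ) ^ (1 / 2 : ℝ) := by
  obtain ⟨C, hC0, hC⟩ := sum_err_sq
  refine ⟨16 * C + 8, by positivity, ?_⟩
  intro Q _
  have hQ1 : 1 ≤ Q := Nat.one_le_iff_ne_zero.2 (NeZero.ne Q)
  have hQr : (1 : ℝ) ≤ Q := by exact_mod_cast hQ1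
  have hq : 1 ≤ (Q : ℝ) ^ (1 / 2 : ℝ) := Real.one_le_rpow hQr (by norm_num)
  rcases le_or_gt Q 8 with h8 | h8
  · have h1 : (bad Q).card ≤ 8 := (Finset.card_le_univ _).trans ((card_char_le Q).trans h8)
    have h2 : ((bad Q).card : ℝ) ≤ 8 := by exact_mod_cast h1
    nlinarith
  have h8r : (8 : ℝ) ≤ Q := by exact_mod_cast h8.le
  have key : ∀ χ ∈ bad Q, (1 : ℝ) ≤ 16 * ‖LN χ (Q ^ 3) * MM χ - 1‖ ^ 2 := by
    intro χ hχ
    simp only [bad, Finset.mem_filter, Finset.mem_univ, true_and] at hχ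
    have h1 := LN_approx hχ.1 (Q ^ 3)
    have h2 := MM_le χ
    have h3 : ‖(χ.LFunction 1 - LN χ (Q ^ 3)) * MM χ‖ ≤ 1 / 4 := by
      rw [norm_mul]
      calc _ ≤ (2 * Q / (((Q ^ 3 : ℕ) : ℝ) + 1)) * Q := by gcongr
        _ ≤ 1 / 4 := by
          push_cast
          rw [div_mul_eq_mul_div, div_le_div_iff₀ (by positivity) (by norm_num)]
          nlinarith [sq_nonneg (Q : ℝ), mul_nonneg (sq_nonneg (Q : ℝ)) (sub_nonneg.2 h8r)]
    have h4 : ‖χ.LFunction 1 * MM χ - 1‖ ≤ ‖LN χ (Q ^ 3) * MM χ - 1‖ +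
        ‖(χ.LFunction 1 - LN χ (Q ^ 3)) * MM χ‖ := by
      refine le_trans (le_of_eq ?_) (norm_add_le _ _)
      congr 1; ring
    have h5 : 1 / 4 ≤ ‖LN χ (Q ^ 3) * MM χ - 1‖ := by linarith [hχ.2]
    nlinarith
  calc ((bad Q).card : ℝ) = ∑ χ ∈ bad Q, (1 : ℝ) := by simp
    _ ≤ ∑ χ ∈ bad Q, 16 * ‖LN χ (Q ^ 3) * MM χ - 1‖ ^ 2 := Finset.sum_le_sum key
    _ ≤ ∑ χ : DirichletCharacter ℂ Q, 16 * ‖LN χ (Q ^ 3) * MM χ - 1‖ ^ 2 :=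
        Finset.sum_le_sum_of_subset_of_nonneg (Finset.subset_univ _)
          fun _ _ _ => by positivity
    _ = 16 * ∑ χ : DirichletCharacter ℂ Q, ‖LN χ (Q ^ 3) * MM χ - 1‖ ^ 2 := by
        rw [Finset.mul_sum]
    _ ≤ 16 * (C * (Q : ℝ) ^ (1 / 2 : ℝ)) := by gcongr; exact hC Q
    _ ≤ _ := by nlinarith

lemma good_bound {Q : ℕ} [NeZero Q] {χ : DirichletCharacter ℂ Q} (hχ : χ ≠ 1) (hb : χ ∉ bad Q) :
    (‖χ.LFunction 1‖ ^ 2)⁻¹ ≤ 4 * ‖MM χ‖ ^ 2 := by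
  have h : ‖χ.LFunction 1 * MM χ - 1‖ < 1 / 2 := by
    by_contra hh
    exact hb (by simp only [bad, Finset.mem_filter, Finset.mem_univ, true_and]; exact ⟨hχ, not_lt.1 hh⟩)
  have h1 : 1 / 2 ≤ ‖χ.LFunction 1‖ * ‖MM χ‖ := by
    rw [← norm_mul]
    have := norm_sub_norm_le (1 : ℂ) (χ.LFunction 1 * MM χ)
    rw [norm_sub_rev, norm_one] at this
    linarith
  have h0 : 0 < ‖χ.LFunction 1‖ := by
    rcases (norm_nonneg (χ.LFunction 1)).eq_or_lt with h | h
    · rw [← h] at h1; norm_num at h1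
    · exact h
  rw [inv_le_iff_one_le_mul₀ (by positivity)]
  nlinarith

lemma card_real_prime (p : ℕ) (hp : p.Prime) [NeZero p] (S : Finset (DirichletCharacter ℂ p))
    (hS : ∀ χ ∈ S, χ ^ 2 = 1) : S.card ≤ 2 := by
  haveI := Fact.mk hp
  obtain ⟨e⟩ := DirichletCharacter.mulEquiv_units ℂ p
  haveI : IsCyclic (ZMod p)ˣ := inferInstance
  have h2 := IsCyclic.card_pow_eq_one_le (α := (ZMod p)ˣ) (n := 2) (by norm_num)
  calc S.card = (S.map e.toEquiv.toEmbedding).card := by rw [Finset.card_map]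
    _ ≤ _ := Finset.card_le_card (by
        intro x hx
        rw [Finset.mem_map] at hx
        obtain ⟨χ, hχ, rfl⟩ := hx
        simp only [Finset.mem_filter, Finset.mem_univ, true_and]
        change (e χ) ^ 2 = 1
        rw [← map_pow, hS χ hχ, map_one])
    _ ≤ 2 := h2

end NSM

namespace NSM

open scoped Classical in
lemma T_bound : ∃ c0 > (0 : ℝ), ∃ C > (0 : ℝ), ∀ (Q : ℕ) [NeZero Q] (l R : ℝ), 1 ≤ l →
    Real.log Q ≤ l →
    (∀ S : Finset (DirichletCharacter ℂ Q), S ⊆ bad Q → (∀ χ ∈ S, χ ^ 2 = 1) → (S.card : ℝ) ≤ R) →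
    (∀ χ : DirichletCharacter ℂ Q, χ ≠ 1 → ∀ x : ℝ, 1 - c0 / l ≤ x → χ.LFunction x ≠ 0) →
    ∑ χ : DirichletCharacter ℂ Q with χ ≠ 1, (‖χ.LFunction 1‖ ^ 2)⁻¹ ≤ C * Q + C * l ^ 2 * R := by
  obtain ⟨c0, hc0, c2, hc2, hreal⟩ := real_lower
  obtain ⟨c1, hc1, hcomp⟩ := complex_lower
  obtain ⟨C1, hC1, hM⟩ := sum_MM_sq
  obtain ⟨C2, hC2, hB⟩ := card_bad
  refine ⟨c0, hc0, (4 * C1 + C2 * (c1 ^ 2)⁻¹) + (c2 ^ 2)⁻¹, by positivity, ?_⟩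
  intro Q _ l R hl hlQ hR hz
  have hQ1 : 1 ≤ Q := Nat.one_le_iff_ne_zero.2 (NeZero.ne Q)
  have hQr : (1 : ℝ) ≤ Q := by exact_mod_cast hQ1
  have hR0 : 0 ≤ R := by simpa using hR ∅ (by simp) (by simp)
  set q4 : ℝ := (Q : ℝ) ^ (1 / 4 : ℝ) with hq4
  have hq40 : 0 < q4 := by positivity
  have hterm : ∀ χ : DirichletCharacter ℂ Q, χ ≠ 1 → (‖χ.LFunction 1‖ ^ 2)⁻¹ ≤
      4 * ‖MM χ‖ ^ 2 + (if χ ∈ bad Q then (c1 ^ 2)⁻¹ * q4 else 0) +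
        (if χ ∈ (bad Q).filter (fun χ => χ ^ 2 = 1) then (c2 ^ 2)⁻¹ * l ^ 2 else 0) := by
    intro χ hχ
    by_cases hb : χ ∈ bad Q
    · by_cases h2 : χ ^ 2 = 1
      · have h := hreal Q χ hχ h2 l hl hlQ (hz χ hχ)
        have h3 : (‖χ.LFunction 1‖ ^ 2)⁻¹ ≤ (c2 ^ 2)⁻¹ * l ^ 2 := by
          calc (‖χ.LFunction 1‖ ^ 2)⁻¹ ≤ ((c2 / l) ^ 2)⁻¹ := by gcongr
            _ = _ := by rw [div_pow, inv_div]; ring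
        simp only [Finset.mem_filter, hb, h2, and_self, if_true]
        have : 0 ≤ 4 * ‖MM χ‖ ^ 2 + (c1 ^ 2)⁻¹ * q4 := by positivity
        linarith
      · have h := hcomp Q χ h2
        have h3 : (‖χ.LFunction 1‖ ^ 2)⁻¹ ≤ (c1 ^ 2)⁻¹ * q4 := by
          calc (‖χ.LFunction 1‖ ^ 2)⁻¹ ≤ ((c1 * (Q : ℝ) ^ (-(1 / 8) : ℝ)) ^ 2)⁻¹ := by gcongr
            _ = (c1 ^ 2)⁻¹ * (((Q : ℝ) ^ (-(1 / 8) : ℝ)) ^ 2)⁻¹ := by rw [mul_pow, mul_inv]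
            _ = _ := by
              rw [hq4, ← Real.rpow_natCast ((Q : ℝ) ^ (-(1 / 8) : ℝ)),
                ← Real.rpow_mul (by positivity), ← Real.rpow_neg (by positivity)]
              norm_num
        simp only [Finset.mem_filter, hb, h2, and_false, if_true, if_false]
        have : 0 ≤ 4 * ‖MM χ‖ ^ 2 := by positivity
        linarith
    · have := good_bound hχ hb
      simp only [Finset.mem_filter, hb, false_and, if_false]
      linarith
  have hq : q4 * (Q : ℝ) ^ (1 / 2 : ℝ) ≤ Q := by
    rw [hq4, ← Real.rpow_add (by positivity)]
    calc _ ≤ (Q : ℝ) ^ (1 : ℝ) := Real.rpow_le_rpow_of_exponent_le hQr (by norm_num)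
      _ = _ := Real.rpow_one _
  calc _ ≤ ∑ χ : DirichletCharacter ℂ Q with χ ≠ 1, (4 * ‖MM χ‖ ^ 2 +
          (if χ ∈ bad Q then (c1 ^ 2)⁻¹ * q4 else 0) +
          (if χ ∈ (bad Q).filter (fun χ => χ ^ 2 = 1) then (c2 ^ 2)⁻¹ * l ^ 2 else 0)) :=
        Finset.sum_le_sum fun χ hχ => hterm χ (Finset.mem_filter.1 hχ).2
    _ ≤ ∑ χ : DirichletCharacter ℂ Q, (4 * ‖MM χ‖ ^ 2 +
          (if χ ∈ bad Q then (c1 ^ 2)⁻¹ * q4 else 0) +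
          (if χ ∈ (bad Q).filter (fun χ => χ ^ 2 = 1) then (c2 ^ 2)⁻¹ * l ^ 2 else 0)) :=
        Finset.sum_le_sum_of_subset_of_nonneg (Finset.subset_univ _) fun χ _ _ => by positivity
    _ = 4 * ∑ χ : DirichletCharacter ℂ Q, ‖MM χ‖ ^ 2 + (bad Q).card * ((c1 ^ 2)⁻¹ * q4) +
          ((bad Q).filter (fun χ => χ ^ 2 = 1)).card * ((c2 ^ 2)⁻¹ * l ^ 2) := by
        rw [Finset.sum_add_distrib, Finset.sum_add_distrib, ← Finset.mul_sum]
        simp only [Finset.sum_ite_mem, Finset.univ_inter, Finset.sum_const, nsmul_eq_mul]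
    _ ≤ 4 * (C1 * Q) + (C2 * (Q : ℝ) ^ (1 / 2 : ℝ)) * ((c1 ^ 2)⁻¹ * q4) +
          R * ((c2 ^ 2)⁻¹ * l ^ 2) := by
        gcongr
        · exact hM Q
        · exact hB Q
        · exact hR _ (Finset.filter_subset _ _) (fun χ hχ => (Finset.mem_filter.1 hχ).2)
    _ = 4 * C1 * Q + C2 * (c1 ^ 2)⁻¹ * (q4 * (Q : ℝ) ^ (1 / 2 : ℝ)) +
          (c2 ^ 2)⁻¹ * (l ^ 2 * R) := by ring
    _ ≤ 4 * C1 * Q + C2 * (c1 ^ 2)⁻¹ * Q + (c2 ^ 2)⁻¹ * (l ^ 2 * R) := by gcongr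
    _ ≤ _ := by
        have h1 : 0 ≤ (c2 ^ 2)⁻¹ * Q := by positivity
        have h2 : 0 ≤ (4 * C1 + C2 * (c1 ^ 2)⁻¹) * (l ^ 2 * R) := by positivity
        linarith

lemma LFunction_lift {p j k : ℕ} (hp : p.Prime) (hj : 1 ≤ j) [NeZero (p ^ j)] [NeZero (p ^ k)]
    (h : p ^ j ∣ p ^ k) {ψ : DirichletCharacter ℂ (p ^ j)} (hψ : ψ ≠ 1) (s : ℂ) :
    LFunction (changeLevel h ψ) s = LFunction ψ s := by
  rw [LFunction_changeLevel h ψ (Or.inl hψ)]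
  rw [Finset.prod_eq_one, mul_one]
  intro x hx
  have hx' : x = p := by
    have h1 := Nat.prime_of_mem_primeFactors hx
    exact (Nat.prime_dvd_prime_iff_eq h1 hp).1 (h1.dvd_of_dvd_pow (Nat.dvd_of_mem_primeFactors hx))
  subst hx'
  have : ψ (x : ZMod (x ^ j)) = 0 := by
    apply MulChar.map_nonunit
    rw [ZMod.isUnit_iff_coprime]
    intro hc
    have := Nat.Coprime.coprime_dvd_right (dvd_pow_self x (by omega : j ≠ 0)) hc
    rw [Nat.coprime_self] at this
    exact hp.one_lt.ne' this
  rw [this]; simp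

open scoped Classical in
lemma conductor_sum {p k : ℕ} (hp : p.Prime) [NeZero (p ^ k)] (T : ℕ → ℝ)
    (hT : ∀ j ∈ Finset.Icc 1 k, ∀ _ : NeZero (p ^ j),
      ∑ ψ : DirichletCharacter ℂ (p ^ j) with ψ ≠ 1, (‖ψ.LFunction 1‖ ^ 2)⁻¹ ≤ T j) :
    (∑ χ : DirichletCharacter ℂ (p ^ k),
            if χ ≠ 1 ∧ χ.Even then 1 / ((χ.conductor : ℝ) * ‖χ.LFunction 1‖ ^ 2) else 0) ≤
      ∑ j ∈ Finset.Icc 1 k, ((p : ℝ) ^ j)⁻¹ * T j := by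
  have hinj : Set.InjOn (fun j : ℕ => p ^ j) (Finset.Icc 1 k : Finset ℕ) := by
    intro a _ b _ h
    exact Nat.pow_right_injective hp.two_le h
  calc _ ≤ ∑ χ : DirichletCharacter ℂ (p ^ k),
            if χ ≠ 1 then 1 / ((χ.conductor : ℝ) * ‖χ.LFunction 1‖ ^ 2) else 0 := by
        refine Finset.sum_le_sum fun χ _ => ?_
        by_cases h : χ ≠ 1 <;> by_cases h' : χ.Even <;> simp [h, h']
        positivity
    _ = ∑ χ : DirichletCharacter ℂ (p ^ k) with χ ≠ 1,
          1 / ((χ.conductor : ℝ) * ‖χ.LFunction 1‖ ^ 2) := (Finset.sum_filter _ _).symm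
    _ = ∑ f ∈ (Finset.Icc 1 k).image (fun j => p ^ j),
          ∑ χ ∈ (Finset.univ.filter (fun χ : DirichletCharacter ℂ (p ^ k) => χ ≠ 1)).filter
            (fun χ => χ.conductor = f), 1 / ((χ.conductor : ℝ) * ‖χ.LFunction 1‖ ^ 2) := by
        symm
        apply Finset.sum_fiberwise_of_maps_to
        intro χ hχ
        have hχ1 := (Finset.mem_filter.1 hχ).2
        obtain ⟨j, hj, hj2⟩ := (Nat.dvd_prime_pow hp).1 χ.conductor_dvd_level
        refine Finset.mem_image.2 ⟨j, Finset.mem_Icc.2 ⟨?_, hj⟩, hj2.symm⟩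
        rcases Nat.eq_zero_or_pos j with h0 | h0
        · exfalso
          rw [h0, pow_zero] at hj2
          exact hχ1 (DirichletCharacter.eq_one_iff_conductor_eq_one.2 hj2)
        · exact h0
    _ = ∑ j ∈ Finset.Icc 1 k,
          ∑ χ ∈ (Finset.univ.filter (fun χ : DirichletCharacter ℂ (p ^ k) => χ ≠ 1)).filter
            (fun χ => χ.conductor = p ^ j), 1 / ((χ.conductor : ℝ) * ‖χ.LFunction 1‖ ^ 2) :=
        Finset.sum_image hinj
    _ ≤ _ := by
        refine Finset.sum_le_sum fun j hj => ?_
        have hj' := Finset.mem_Icc.1 hj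
        have hd : p ^ j ∣ p ^ k := pow_dvd_pow p hj'.2
        have inst : NeZero (p ^ j) := ⟨pow_ne_zero j hp.ne_zero⟩
        have hinj2 : Function.Injective (changeLevel (R := ℂ) hd) := changeLevel_injective hd
        calc _ ≤ ∑ χ ∈ (Finset.univ.filter (fun ψ : DirichletCharacter ℂ (p ^ j) => ψ ≠ 1)).image
                (changeLevel hd), ((p : ℝ) ^ j)⁻¹ * (‖χ.LFunction 1‖ ^ 2)⁻¹ := by
              have e : ∀ χ ∈ (Finset.univ.filter
                  (fun χ : DirichletCharacter ℂ (p ^ k) => χ ≠ 1)).filter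
                  (fun χ => χ.conductor = p ^ j),
                  1 / ((χ.conductor : ℝ) * ‖χ.LFunction 1‖ ^ 2) =
                  ((p : ℝ) ^ j)⁻¹ * (‖χ.LFunction 1‖ ^ 2)⁻¹ := by
                intro χ hχ
                rw [(Finset.mem_filter.1 hχ).2]
                push_cast
                rw [one_div, mul_inv]
              rw [Finset.sum_congr rfl e]
              apply Finset.sum_le_sum_of_subset_of_nonneg
              · intro χ hχ
                simp only [Finset.mem_filter, Finset.mem_univ, true_and] at hχ
                have hf := χ.factorsThrough_conductor
                rw [hχ.2] at hf
                obtain ⟨h1, ψ, h2⟩ := hf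
                refine Finset.mem_image.2 ⟨ψ, ?_, h2.symm⟩
                simp only [Finset.mem_filter, Finset.mem_univ, true_and]
                rintro rfl
                apply hχ.1
                rw [h2, map_one]
              · intro _ _ _; positivity
          _ = ∑ ψ : DirichletCharacter ℂ (p ^ j) with ψ ≠ 1,
                ((p : ℝ) ^ j)⁻¹ * (‖ψ.LFunction 1‖ ^ 2)⁻¹ := by
              rw [Finset.sum_image hinj2.injOn]
              refine Finset.sum_congr rfl fun ψ hψ => ?_
              rw [LFunction_lift hp hj'.1 hd (Finset.mem_filter.1 hψ).2]
          _ ≤ _ := by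
              rw [← Finset.mul_sum]
              gcongr
              exact hT j hj inst

end NSM

namespace NSM

lemma geom_sum_le (k : ℕ) : ∑ j ∈ Finset.Icc 1 k, (3 / 4 : ℝ) ^ (j - 1) ≤ 4 - 4 * (3 / 4 : ℝ) ^ k := by
  induction k with
  | zero => simp
  | succ n ih =>
    rw [Finset.sum_Icc_succ_top (by omega), Nat.add_sub_cancel]
    rw [pow_succ]; linarith

open scoped Classical in
lemma core : ∃ c0 > (0 : ℝ), ∃ C > (0 : ℝ), ∀ (p k : ℕ) (_hp : p.Prime) (_hk : 1 ≤ k)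
    (_ : NeZero (p ^ k)), 3 ≤ p ^ k →
    (∀ χ : DirichletCharacter ℂ (p ^ k), χ ≠ 1 → ∀ β : ℝ,
            1 - c0 / Real.log (p ^ k : ℕ) ≤ β → χ.LFunction (β : ℂ) ≠ 0) →
        (∑ χ : DirichletCharacter ℂ (p ^ k),
            if χ ≠ 1 ∧ χ.Even then 1 / ((χ.conductor : ℝ) * ‖χ.LFunction 1‖ ^ 2) else 0) ≤
          C * k + C * (Real.log (p ^ k : ℕ)) ^ 2 / p := by
  obtain ⟨c0, hc0, C, hC, hT⟩ := T_bound
  obtain ⟨C2, hC2, hB⟩ := card_bad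
  refine ⟨c0, hc0, C + C * (2 + 2 * C2) * 4, by positivity, ?_⟩
  intro p k hp hk _ h3 hz
  set l : ℝ := Real.log (p ^ k : ℕ) with hl
  have hl1 : 1 ≤ l := by
    rw [hl, Real.le_log_iff_exp_le (by positivity)]
    have : (3 : ℝ) ≤ (p ^ k : ℕ) := by exact_mod_cast h3
    linarith [Real.exp_one_lt_d9]
  have hp2 : (2 : ℝ) ≤ p := by exact_mod_cast hp.two_le
  have hp0 : (0 : ℝ) < p := by linarith
  set s : ℝ := Real.sqrt p with hs
  have hs0 : 0 < s := Real.sqrt_pos.2 hp0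
  have hss : s ^ 2 = p := Real.sq_sqrt hp0.le
  have hs43 : 4 / 3 ≤ s := by
    apply Real.le_sqrt_of_sq_le; norm_num; linarith
  set R : ℕ → ℝ := fun j => if j = 1 then 2 else C2 * s ^ j with hR
  have hsum := conductor_sum (k := k) hp (fun j => C * ((p : ℝ) ^ j) + C * l ^ 2 * R j) (by
    intro j hj _
    have hj' := Finset.mem_Icc.1 hj
    have hd : p ^ j ∣ p ^ k := pow_dvd_pow p hj'.2
    have := hT (p ^ j) l (R j) hl1 (by
      apply Real.log_le_log
      · exact_mod_cast pow_pos hp.pos j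
      · exact_mod_cast Nat.pow_le_pow_right hp.pos hj'.2) (by
      intro S hS hS2
      by_cases h1 : j = 1
      · subst h1
        simp only [hR, if_true]
        have key : ∀ (Q : ℕ) (_ : Q = p) [NeZero Q] (S : Finset (DirichletCharacter ℂ Q)),
            (∀ χ ∈ S, χ ^ 2 = 1) → S.card ≤ 2 := by
          rintro Q rfl _ S hS
          exact card_real_prime Q hp S hS
        exact_mod_cast key _ (pow_one p) S hS2
      · simp only [hR, h1, if_false]
        have h5 : ((p ^ j : ℕ) : ℝ) ^ (1 / 2 : ℝ) = s ^ j := by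
          push_cast
          rw [← Real.sqrt_eq_rpow, ← hss, ← pow_mul, mul_comm, pow_mul, Real.sqrt_sq (by positivity)]
        have h6 := hB (p ^ j)
        rw [h5] at h6
        have h7 : (S.card : ℝ) ≤ (bad (p ^ j)).card := by exact_mod_cast Finset.card_le_card hS
        linarith) (by
      intro ψ hψ x hx
      rw [← LFunction_lift hp hj'.1 hd hψ]
      apply hz _ _ _ hx
      rwa [Ne, changeLevel_eq_one_iff])
    push_cast at this
    exact this)
  refine hsum.trans ?_
  have hterm : ∀ j ∈ Finset.Icc 1 k, ((p : ℝ) ^ j)⁻¹ * (C * ((p : ℝ) ^ j) + C * l ^ 2 * R j) ≤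
      C + C * l ^ 2 * ((2 + 2 * C2) / p) * (3 / 4) ^ (j - 1) := by
    intro j hj
    have hj' := Finset.mem_Icc.1 hj
    have h1 : ((p : ℝ) ^ j)⁻¹ * R j ≤ ((2 + 2 * C2) / p) * (3 / 4) ^ (j - 1) := by
      by_cases h : j = 1
      · subst h
        simp only [hR, if_true, pow_one, Nat.sub_self, pow_zero, mul_one]
        rw [inv_mul_eq_div]
        gcongr
        linarith
      · simp only [hR, h, if_false]
        obtain ⟨i, rfl⟩ : ∃ i, j = i + 2 := ⟨j - 2, by omega⟩
        have e : ((p : ℝ) ^ (i + 2))⁻¹ * (C2 * s ^ (i + 2)) = C2 / p * (s⁻¹) ^ i := by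
          rw [← hss, inv_pow]
          field_simp
          ring
        rw [e, show i + 2 - 1 = i + 1 by omega, pow_succ]
        have h4 : (s⁻¹) ^ i ≤ (3 / 4 : ℝ) ^ i := by
          apply pow_le_pow_left₀ (by positivity)
          rw [inv_le_comm₀ hs0 (by norm_num)]
          norm_num; linarith
        calc C2 / p * (s⁻¹) ^ i ≤ C2 / p * (3 / 4 : ℝ) ^ i := by gcongr
          _ ≤ ((2 + 2 * C2) * (3 / 4)) / p * (3 / 4 : ℝ) ^ i := by gcongr; linarith
          _ = _ := by ring
    calc _ = C + C * l ^ 2 * (((p : ℝ) ^ j)⁻¹ * R j) := by field_simp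
      _ ≤ C + C * l ^ 2 * (((2 + 2 * C2) / p) * (3 / 4) ^ (j - 1)) := by gcongr
      _ = _ := by ring
  calc _ ≤ ∑ j ∈ Finset.Icc 1 k, (C + C * l ^ 2 * ((2 + 2 * C2) / p) * (3 / 4) ^ (j - 1)) :=
        Finset.sum_le_sum hterm
    _ = k * C + C * l ^ 2 * ((2 + 2 * C2) / p) * ∑ j ∈ Finset.Icc 1 k, (3 / 4 : ℝ) ^ (j - 1) := by
        rw [Finset.sum_add_distrib, ← Finset.mul_sum]; simp
    _ ≤ k * C + C * l ^ 2 * ((2 + 2 * C2) / p) * 4 := by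
        gcongr
        have := geom_sum_le k
        have : 0 < (3 / 4 : ℝ) ^ k := by positivity
        linarith
    _ ≤ _ := by
        have h1 : 0 ≤ C * (2 + 2 * C2) * 4 * k := by positivity
        have h2 : 0 ≤ C * l ^ 2 / p := by positivity
        have h3 : (C + C * (2 + 2 * C2) * 4) * l ^ 2 / p =
          C * l ^ 2 / p + C * l ^ 2 * ((2 + 2 * C2) / p) * 4 := by ring
        rw [h3]; linarith

open scoped Classical in
lemma sum_two {p k : ℕ} (hp : p.Prime) (hk : 1 ≤ k) [NeZero (p ^ k)] (h3 : ¬ 3 ≤ p ^ k) :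
    (∑ χ : DirichletCharacter ℂ (p ^ k),
      if χ ≠ 1 ∧ χ.Even then 1 / ((χ.conductor : ℝ) * ‖χ.LFunction 1‖ ^ 2) else 0) = 0 := by
  have h2 : p ^ k = 2 := by
    have h1 : p ^ 1 ≤ p ^ k := Nat.pow_le_pow_right hp.pos hk
    rw [pow_one] at h1
    have := hp.two_le
    omega
  have key : ∀ (Q : ℕ) (_ : Q = 2) (χ : DirichletCharacter ℂ Q), χ = 1 := by
    rintro Q rfl χ
    ext u
    have : u = 1 := Subsingleton.elim (α := (ZMod 2)ˣ) _ _
    subst this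
    simp
  exact Finset.sum_eq_zero fun χ _ => by simp [key _ h2 χ]

lemma loglog3 : 0 < Real.log (Real.log 3) := by
  apply Real.log_pos
  rw [Real.lt_log_iff_exp_lt (by norm_num)]
  linarith [Real.exp_one_lt_d9]

lemma X_eq {p k : ℕ} (hp : p.Prime) (hk : 1 ≤ k) :
    Real.log k + Real.log (Real.log p) = Real.log (k * Real.log p) := by
  have hlp : 0 < Real.log p := Real.log_pos (by exact_mod_cast hp.one_lt)
  have hk0 : (0 : ℝ) < k := by exact_mod_cast hk
  rw [Real.log_mul hk0.ne' hlp.ne']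

lemma X_lower {p k : ℕ} (hp : p.Prime) (hk : 1 ≤ k) (h3 : 3 ≤ p ^ k) :
    Real.log (Real.log 3) ≤ Real.log k + Real.log (Real.log p) := by
  rw [X_eq hp hk]
  have h0 : 0 < Real.log 3 := Real.log_pos (by norm_num)
  apply Real.log_le_log h0
  rw [← Real.log_pow]
  apply Real.log_le_log (by norm_num)
  exact_mod_cast h3

lemma X_lower2 {c : ℝ} (hc : 0 < c) : ∃ δ > (0 : ℝ), ∀ p k : ℕ, p.Prime → 1 ≤ k → 3 ≤ p ^ k →
    c * p / (Real.log p) ^ 4 ≤ k →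
    δ * Real.log p ≤ Real.log k + Real.log (Real.log p) := by
  set m : ℝ := Real.log (c / 1728) with hm
  set K : ℝ := max 1 (-4 * m) with hK
  have hK1 : 1 ≤ K := le_max_left _ _
  have hK2 : -4 * m ≤ K := le_max_right _ _
  have hl3 := loglog3
  refine ⟨min (1 / 2) (Real.log (Real.log 3) / K), by positivity, ?_⟩
  intro p k hp hk h3 hck
  have hlp : 0 < Real.log p := Real.log_pos (by exact_mod_cast hp.one_lt)
  have hk0 : (0 : ℝ) < k := by exact_mod_cast hk
  have hp0 : (0 : ℝ) < p := by exact_mod_cast hp.pos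
  rcases le_or_gt (Real.log p) K with hlt | hlt
  · calc _ ≤ Real.log (Real.log 3) / K * K := by gcongr; exact min_le_right _ _
      _ = Real.log (Real.log 3) := by field_simp
      _ ≤ _ := X_lower hp hk h3
  · have h1 : (Real.log p) ≤ 12 * (p : ℝ) ^ (1 / 12 : ℝ) := by
      have := Real.log_le_rpow_div hp0.le (by norm_num : (0 : ℝ) < 1 / 12)
      linarith
    have h2 : (Real.log p) ^ 3 ≤ 1728 * (p : ℝ) ^ (1 / 4 : ℝ) := by
      calc (Real.log p) ^ 3 ≤ (12 * (p : ℝ) ^ (1 / 12 : ℝ)) ^ 3 := by gcongr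
        _ = _ := by
          rw [mul_pow, ← Real.rpow_natCast ((p : ℝ) ^ (1 / 12 : ℝ)), ← Real.rpow_mul hp0.le]
          norm_num
    have h4 : c / 1728 * (p : ℝ) ^ (3 / 4 : ℝ) ≤ k * Real.log p := by
      have e : (p : ℝ) ^ (3 / 4 : ℝ) * (p : ℝ) ^ (1 / 4 : ℝ) = p := by
        rw [← Real.rpow_add hp0]; norm_num
      rw [div_le_iff₀ (by positivity)] at hck
      have h5 : c * p ≤ k * Real.log p * (1728 * (p : ℝ) ^ (1 / 4 : ℝ)) := by
        calc c * p ≤ k * Real.log p * (Real.log p) ^ 3 := by linarith [hck]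
          _ ≤ _ := by gcongr
      have hq : 0 < (p : ℝ) ^ (1 / 4 : ℝ) := by positivity
      refine le_of_mul_le_mul_right ?_ hq
      calc c / 1728 * (p : ℝ) ^ (3 / 4 : ℝ) * (p : ℝ) ^ (1 / 4 : ℝ) = c / 1728 * p := by
            rw [mul_assoc, e]
        _ ≤ _ := by linarith
    rw [X_eq hp hk]
    have h6 := Real.log_le_log (by positivity) h4
    rw [Real.log_mul (by positivity) (by positivity), Real.log_rpow hp0, ← hm] at h6
    calc _ ≤ 1 / 2 * Real.log p := by gcongr; exact min_le_left _ _
      _ ≤ _ := by linarith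

end NSM

open scoped Classical in
/-- There are constants `c0 > 0` (the zero-free-region constant) and `C > 0`
such that for every prime `p` and `k ≥ 1` with `q = p^k`, assuming no exceptional zero,
`Σ_{χ ≠ χ0, χ even} (f_χ |L(1,χ)|²)⁻¹ ≤ C k + C k² (log p)² (log k + log log p)² / p`;
in particular, when `k ≥ c·p/(log p)⁴` the sum is `≪ k² (log p)² (log k + log log p)² / p`. -/
theorem negative_square_moment_with_conductor_upper :
    ∃ c0 > (0 : ℝ), ∃ C > (0 : ℝ),
      (∀ (p k : ℕ) (hp : p.Prime) (_hk : 1 ≤ k),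
        haveI : NeZero (p ^ k) := ⟨pow_ne_zero k hp.ne_zero⟩
        (∀ χ : DirichletCharacter ℂ (p ^ k), χ ≠ 1 → ∀ β : ℝ,
            1 - c0 / Real.log (p ^ k : ℕ) ≤ β → χ.LFunction (β : ℂ) ≠ 0) →
        (∑ χ : DirichletCharacter ℂ (p ^ k),
            if χ ≠ 1 ∧ χ.Even then 1 / ((χ.conductor : ℝ) * ‖χ.LFunction 1‖ ^ 2) else 0) ≤
          C * k + C * k ^ 2 * (Real.log p) ^ 2 *
            (Real.log k + Real.log (Real.log p)) ^ 2 / p) ∧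
      (∀ c > (0 : ℝ), ∃ C' > (0 : ℝ), ∀ (p k : ℕ) (hp : p.Prime) (_hk : 1 ≤ k),
        haveI : NeZero (p ^ k) := ⟨pow_ne_zero k hp.ne_zero⟩
        (∀ χ : DirichletCharacter ℂ (p ^ k), χ ≠ 1 → ∀ β : ℝ,
            1 - c0 / Real.log (p ^ k : ℕ) ≤ β → χ.LFunction (β : ℂ) ≠ 0) →
        c * p / (Real.log p) ^ 4 ≤ k →
        (∑ χ : DirichletCharacter ℂ (p ^ k),
            if χ ≠ 1 ∧ χ.Even then 1 / ((χ.conductor : ℝ) * ‖χ.LFunction 1‖ ^ 2) else 0) ≤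
          C' * k ^ 2 * (Real.log p) ^ 2 * (Real.log k + Real.log (Real.log p)) ^ 2 / p) := by
  obtain ⟨c0, hc0, C, hC, hmain⟩ := NSM.core
  have hl3 := NSM.loglog3
  set lam : ℝ := Real.log (Real.log 3) with hlam
  have hD : ∀ (p k : ℕ) (hp : p.Prime) (_hk : 1 ≤ k),
        haveI : NeZero (p ^ k) := ⟨pow_ne_zero k hp.ne_zero⟩
        (∀ χ : DirichletCharacter ℂ (p ^ k), χ ≠ 1 → ∀ β : ℝ,
            1 - c0 / Real.log (p ^ k : ℕ) ≤ β → χ.LFunction (β : ℂ) ≠ 0) →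
        (∑ χ : DirichletCharacter ℂ (p ^ k),
            if χ ≠ 1 ∧ χ.Even then 1 / ((χ.conductor : ℝ) * ‖χ.LFunction 1‖ ^ 2) else 0) ≤
          (C + C / lam ^ 2) * k + (C + C / lam ^ 2) * k ^ 2 * (Real.log p) ^ 2 *
            (Real.log k + Real.log (Real.log p)) ^ 2 / p := by
    intro p k hp hk
    have inst : NeZero (p ^ k) := ⟨pow_ne_zero k hp.ne_zero⟩
    intro hz
    by_cases h3 : 3 ≤ p ^ k
    · refine (hmain p k hp hk inst h3 hz).trans ?_
      have hX := NSM.X_lower hp hk h3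
      rw [← hlam] at hX
      set X := Real.log k + Real.log (Real.log p)
      have e : Real.log (p ^ k : ℕ) = k * Real.log p := by
        push_cast; rw [Real.log_pow]
      rw [e]
      have h1 : 1 ≤ X ^ 2 / lam ^ 2 := by
        rw [one_le_div (by positivity)]; gcongr
      have h2 : C * (k * Real.log p) ^ 2 / p ≤
          (C / lam ^ 2) * k ^ 2 * (Real.log p) ^ 2 * X ^ 2 / p := by
        calc C * (k * Real.log p) ^ 2 / p = C * (k * Real.log p) ^ 2 / p * 1 := by ring
          _ ≤ C * (k * Real.log p) ^ 2 / p * (X ^ 2 / lam ^ 2) := by gcongr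
          _ = _ := by ring
      have h4 : 0 ≤ C / lam ^ 2 * k := by positivity
      have h5 : 0 ≤ C * k ^ 2 * (Real.log p) ^ 2 * X ^ 2 / p := by positivity
      have h6 : (C + C / lam ^ 2) * k ^ 2 * (Real.log p) ^ 2 * X ^ 2 / p =
        C * k ^ 2 * (Real.log p) ^ 2 * X ^ 2 / p +
        (C / lam ^ 2) * k ^ 2 * (Real.log p) ^ 2 * X ^ 2 / p := by ring
      rw [h6]; linarith
    · rw [NSM.sum_two hp hk h3]
      positivity
  refine ⟨c0, hc0, C + C / lam ^ 2, by positivity, hD, ?_⟩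
  intro c hc
  obtain ⟨δ, hδ, hX⟩ := NSM.X_lower2 hc
  set D : ℝ := C + C / lam ^ 2 with hDdef
  have hD0 : 0 < D := by positivity
  refine ⟨D / (δ ^ 2 * c) + D, by positivity, ?_⟩
  intro p k hp hk
  have inst : NeZero (p ^ k) := ⟨pow_ne_zero k hp.ne_zero⟩
  intro hz hck
  by_cases h3 : 3 ≤ p ^ k
  · refine (hD p k hp hk hz).trans ?_
    have h1 := hX p k hp hk h3 hck
    set X := Real.log k + Real.log (Real.log p)
    have hlp : 0 < Real.log p := Real.log_pos (by exact_mod_cast hp.one_lt)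
    have hp0 : (0 : ℝ) < p := by exact_mod_cast hp.pos
    have hk0 : (0 : ℝ) < k := by exact_mod_cast hk
    rw [div_le_iff₀ (by positivity)] at hck
    have h2 : δ ^ 2 * c * p ≤ k * (Real.log p) ^ 2 * X ^ 2 := by
      calc δ ^ 2 * c * p = δ ^ 2 * (c * p) := by ring
        _ ≤ δ ^ 2 * (k * (Real.log p) ^ 4) := by gcongr
        _ = k * (Real.log p) ^ 2 * (δ * Real.log p) ^ 2 := by ring
        _ ≤ _ := by gcongr
    have h4 : D * k ≤ (D / (δ ^ 2 * c)) * k ^ 2 * (Real.log p) ^ 2 * X ^ 2 / p := by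
      calc D * k = (D / (δ ^ 2 * c)) * k * (δ ^ 2 * c * p) / p := by field_simp
        _ ≤ (D / (δ ^ 2 * c)) * k * (k * (Real.log p) ^ 2 * X ^ 2) / p := by gcongr
        _ = _ := by ring
    have h6 : (D / (δ ^ 2 * c) + D) * k ^ 2 * (Real.log p) ^ 2 * X ^ 2 / p =
      (D / (δ ^ 2 * c)) * k ^ 2 * (Real.log p) ^ 2 * X ^ 2 / p +
      D * k ^ 2 * (Real.log p) ^ 2 * X ^ 2 / p := by ring
    rw [h6]; linarith
  · rw [NSM.sum_two hp hk h3]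
    positivity
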